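/- arXiv:2510.13258 — 6 statements merged into one kernel-verified Lean document; each statement's English description precedes it below -/
import Mathlib

section
/- For all n ≥ 2 and all 0 ≤ k < n, |G^I_{2n,2k+2}| = |G^I_{2n,2k}| + Σ_{i=k}^{n−1} |G^I_{2n−2,2i}|, where by convention |G^I_{2m,0}| = 0 for every m. -/
/-- A permutation of `{1, …, m}` (one-line notation `π_1 ⋯ π_m`, where the
entry at position `i+1` is `(π i : ℕ) + 1`) belongs to `G^I` if every ascent
is odd–even: whenever `π_i < π_{i+1}`, the entry `π_i` is odd and `π_{i+1}` is even. -/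
def IsGI {m : ℕ} (π : Equiv.Perm (Fin m)) : Prop :=
  ∀ i j : Fin m, (i : ℕ) + 1 = (j : ℕ) → π i < π j →
    Odd ((π i : ℕ) + 1) ∧ Even ((π j : ℕ) + 1)

/-- The first letter of the one-line notation of `π` is `k`. -/
def FirstIs {m : ℕ} (π : Equiv.Perm (Fin m)) (k : ℕ) : Prop :=
  ∀ i : Fin m, (i : ℕ) = 0 → (π i : ℕ) + 1 = k

section helpers
open Equiv

def RR (x y : ℕ) : Prop := x < y → Odd x ∧ Even y
def LL (V : Finset ℕ) (a : ℕ) : Set (List ℕ) :=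
  {l | (a :: l).Nodup ∧ (∀ x, x ∈ a :: l ↔ x ∈ V) ∧ (a :: l).IsChain RR}
def PP (V : Finset ℕ) (M a : ℕ) : Set (Perm ℕ) :=
  {σ | (∀ x, x ∉ V → σ x = x) ∧ (∀ x, RR x (σ x)) ∧ σ M = a}

theorem foata (m : ℕ) : ∀ (V : Finset ℕ) (M a : ℕ), V.card = m + 1 → M ∈ V → (∀ x ∈ V, x ≤ M) →
    a ∈ V → Nonempty (LL V a ≃ PP V M a) := by
  induction m with
  | zero =>
    intro V M a hc hM hmax ha
    obtain ⟨c, rfl⟩ := Finset.card_eq_one.1 hc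
    obtain rfl : M = c := by simpa using hM
    obtain rfl : a = M := by simpa using ha
    have h1 : LL {a} a = {[]} := by
      ext l
      constructor
      · rintro ⟨h1, h2, h3⟩
        cases l with
        | nil => rfl
        | cons b l =>
          have := (h2 b).1 (by simp)
          simp at this
          simp [this] at h1
      · rintro rfl
        simp [LL]
    have h2 : PP {a} a a = {1} := by
      ext σ
      constructor
      · rintro ⟨h1, h2, h3⟩
        ext x
        by_cases hx : x = a
        · subst hx; simp [h3]
        · simp [h1 x (by simpa using hx)]
      · rintro rfl
        simp [PP, RR]
    rw [h1, h2]
    exact ⟨Equiv.ofUnique _ _⟩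
  | succ m ih =>
    intro V M a hc hM hmax ha
    have hc' : (V.erase a).card = m + 1 := by rw [Finset.card_erase_of_mem ha]; omega
    have hne : (V.erase a).Nonempty := Finset.card_pos.1 (by omega)
    let I := {b : ℕ // b ∈ V.erase a ∧ RR a b}
    have eL : Nonempty ((Σ b : I, LL (V.erase a) b.1) ≃ LL V a) := by
      refine ⟨Equiv.ofBijective (fun p => ⟨p.1.1 :: p.2.1, ?_⟩) ⟨?_, ?_⟩⟩
      · obtain ⟨⟨b, hb, hab⟩, l, h1, h2, h3⟩ := p
        refine ⟨?_, ?_, ?_⟩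
        · rw [List.nodup_cons]
          refine ⟨?_, h1⟩
          rw [h2]; simp
        · intro x
          rw [List.mem_cons, h2]
          simp only [Finset.mem_erase]
          by_cases hx : x = a <;> simp [hx, ha]
        · exact List.IsChain.cons_cons hab h3
      · rintro ⟨⟨b, hb⟩, l, hl⟩ ⟨⟨b', hb'⟩, l', hl'⟩ h
        simp only [Subtype.mk.injEq, List.cons.injEq] at h
        obtain ⟨rfl, rfl⟩ := h
        rfl
      · rintro ⟨l, h1, h2, h3⟩
        cases l with
        | nil =>
          exfalso
          obtain ⟨b, hb⟩ := hne
          have := (h2 b).2 (Finset.mem_of_mem_erase hb)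
          simp at this hb
          exact hb.1 this
        | cons b l =>
          have hb : b ≠ a := by rintro rfl; simp at h1
          refine ⟨⟨⟨b, ?_, ?_⟩, l, ?_, ?_, ?_⟩, rfl⟩
          · rw [Finset.mem_erase]; exact ⟨hb, (h2 b).1 (by simp)⟩
          · exact (List.isChain_cons_cons.1 h3).1
          · exact (List.nodup_cons.1 h1).2
          · intro x
            change x ∈ b :: l ↔ _
            rw [Finset.mem_erase, ← h2, List.mem_cons (b := a)]
            have := (List.nodup_cons.1 h1).1
            constructor
            · intro hx
              exact ⟨by rintro rfl; exact this hx, Or.inr hx⟩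
            · rintro ⟨hx, h | h⟩
              · exact absurd h hx
              · exact h
          · exact (List.isChain_cons_cons.1 h3).2
    have eP : ∃ M', M' ∈ V.erase a ∧ (∀ x ∈ V.erase a, x ≤ M') ∧
        Nonempty ((Σ b : I, PP (V.erase a) M' b.1) ≃ PP V M a) := by
      by_cases haM : a = M
      · subst haM
        refine ⟨(V.erase a).max' hne, Finset.max'_mem _ _, fun x hx => Finset.le_max' _ _ hx, ?_⟩
        have hMm := Finset.max'_mem _ hne
        set M' := (V.erase a).max' hne
        refine ⟨Equiv.ofBijective (fun p => ⟨p.2.1, ?_⟩) ⟨?_, ?_⟩⟩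
        · obtain ⟨⟨b, hb, hab⟩, σ, h1, h2, h3⟩ := p
          exact ⟨fun x hx => h1 x (fun h => hx (Finset.mem_of_mem_erase h)), h2, h1 a (by simp)⟩
        · rintro ⟨⟨b, hb⟩, σ, h1, h2, h3⟩ ⟨⟨b', hb'⟩, σ', h1', h2', h3'⟩ h
          simp only [Subtype.mk.injEq] at h
          subst h
          simp only at h3 h3'
          subst h3
          subst h3'
          rfl
        · rintro ⟨σ, h1, h2, h3⟩
          have hne' : σ M' ≠ a := by
            intro h
            have := σ.injective (h.trans h3.symm)
            rw [this] at hMm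
            simp at hMm
          have hV : σ M' ∈ V := by
            by_contra h
            have := σ.injective (h1 _ h)
            rw [this] at h
            exact h (Finset.mem_of_mem_erase hMm)
          refine ⟨⟨⟨σ M', ?_, ?_⟩, σ, ?_, h2, rfl⟩, rfl⟩
          · exact Finset.mem_erase.2 ⟨hne', hV⟩
          · intro h
            exact absurd (hmax _ hV) (by omega)
          · intro x hx
            by_cases hxa : x = a
            · rw [hxa, h3]
            · exact h1 x (fun h => hx (Finset.mem_erase.2 ⟨hxa, h⟩))
      · refine ⟨M, Finset.mem_erase.2 ⟨Ne.symm haM, hM⟩, fun x hx => hmax x (Finset.mem_of_mem_erase hx), ?_⟩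
        refine ⟨Equiv.ofBijective (fun p => ⟨p.2.1 * swap M a, ?_⟩) ⟨?_, ?_⟩⟩
        · obtain ⟨⟨b, hb, hab⟩, σ, h1, h2, h3⟩ := p
          have hfa : σ a = a := h1 a (by simp)
          refine ⟨?_, ?_, ?_⟩
          · intro x hx
            have e1 : x ≠ M := by rintro rfl; exact hx hM
            have e2 : x ≠ a := by rintro rfl; exact hx ha
            simp only [Perm.mul_apply, swap_apply_of_ne_of_ne e1 e2]
            exact h1 x (fun h => hx (Finset.mem_of_mem_erase h))
          · intro x
            by_cases e1 : x = M
            · subst e1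
              simp only [Perm.mul_apply, swap_apply_left, hfa]
              intro h
              exact absurd (hmax _ ha) (by omega)
            · by_cases e2 : x = a
              · subst e2
                simpa only [Perm.mul_apply, swap_apply_right, h3] using hab
              · simp only [Perm.mul_apply, swap_apply_of_ne_of_ne e1 e2]
                exact h2 x
          · simp [hfa]
        · rintro ⟨⟨b, hb⟩, σ, h1, h2, h3⟩ ⟨⟨b', hb'⟩, σ', h1', h2', h3'⟩ h
          simp only [Subtype.mk.injEq, mul_left_inj] at h
          subst h
          simp only at h3 h3'
          subst h3
          subst h3'
          rfl
        · rintro ⟨σ, h1, h2, h3⟩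
          have hne' : σ a ≠ a := by
            intro h
            exact haM (σ.injective (h.trans h3.symm))
          have hV : σ a ∈ V := by
            by_contra h
            have := σ.injective (h1 _ h)
            rw [this] at h
            exact h ha
          refine ⟨⟨⟨σ a, ?_, h2 a⟩, σ * swap M a, ?_, ?_, ?_⟩, ?_⟩
          · exact Finset.mem_erase.2 ⟨hne', hV⟩
          · intro x hx
            by_cases hxa : x = a
            · simp [hxa, h3]
            · have hxV : x ∉ V := fun h => hx (Finset.mem_erase.2 ⟨hxa, h⟩)
              have e1 : x ≠ M := by rintro rfl; exact hxV hM
              simp only [Perm.mul_apply, swap_apply_of_ne_of_ne e1 hxa]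
              exact h1 x hxV
          · intro x
            by_cases e1 : x = M
            · subst e1
              simp only [Perm.mul_apply, swap_apply_left]
              intro h
              exact absurd (hmax _ hV) (by omega)
            · by_cases e2 : x = a
              · subst e2
                simp only [Perm.mul_apply, swap_apply_right, h3]
                intro h; omega
              · simp only [Perm.mul_apply, swap_apply_of_ne_of_ne e1 e2]
                exact h2 x
          · simp
          · simp [mul_assoc]
    obtain ⟨eL⟩ := eL
    obtain ⟨M', hM', hmax', ⟨eP⟩⟩ := eP
    exact ⟨eL.symm.trans ((Equiv.sigmaCongrRight fun b : I =>
      (ih (V.erase a) M' b.1 hc' hM' hmax' b.2.1).some).trans eP)⟩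

def wd {m : ℕ} (π : Perm (Fin m)) : List ℕ := List.ofFn fun i => (π i : ℕ) + 1

theorem gi_ll (m a : ℕ) :
    Nonempty ({π : Perm (Fin (m + 1)) // IsGI π ∧ FirstIs π a} ≃ LL (Finset.Icc 1 (m + 1)) a) := by
  have key : ∀ π : Perm (Fin (m + 1)), FirstIs π a → a :: (wd π).tail = wd π := by
    intro π h
    have := h 0 rfl
    simp [wd, List.ofFn_succ, this]
  refine ⟨Equiv.ofBijective (fun p => ⟨(wd p.1).tail, ?_⟩) ⟨?_, ?_⟩⟩
  · obtain ⟨π, h1, h2⟩ := p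
    simp only [LL, Set.mem_ofPred_eq, key π h2]
    refine ⟨?_, ?_, ?_⟩
    · rw [wd, List.nodup_ofFn]
      intro i j h
      simp only [Nat.add_right_cancel_iff] at h
      exact π.injective (Fin.ext h)
    · intro x
      simp only [wd, List.mem_ofFn, Finset.mem_Icc]
      constructor
      · rintro ⟨i, rfl⟩
        have := (π i).2
        omega
      · rintro ⟨hx1, hx2⟩
        refine ⟨π.symm ⟨x - 1, by omega⟩, ?_⟩
        simp; omega
    · rw [wd, List.isChain_ofFn]
      intro i hi hlt
      exact h1 _ _ rfl (by rw [Fin.lt_def]; omega)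
  · rintro ⟨π, h1, h2⟩ ⟨π', h1', h2'⟩ h
    simp only [Subtype.mk.injEq] at h
    have h3 := congrArg (List.cons a) h
    rw [key π h2, key π' h2', wd, wd, List.ofFn_inj] at h3
    simp only [Subtype.mk.injEq]
    ext i
    have := congrFun h3 i
    omega
  · rintro ⟨l, h1, h2, h3⟩
    suffices hs : ∃ p : {π : Perm (Fin (m + 1)) // IsGI π ∧ FirstIs π a}, (wd p.1).tail = l by
      obtain ⟨p, hp⟩ := hs
      exact ⟨p, Subtype.ext hp⟩
    have hlen : (a :: l).length = m + 1 := by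
      rw [← List.toFinset_card_of_nodup h1]
      have : (a :: l).toFinset = Finset.Icc 1 (m + 1) := by
        ext x; rw [List.mem_toFinset, h2]
      rw [this]; simp
    generalize hL : a :: l = L at *
    have hb : ∀ i : Fin (m + 1), 1 ≤ L[i] ∧ L[i] ≤ m + 1 := by
      intro i
      have := (h2 L[i]).1 (by simp)
      simpa using this
    let f : Fin (m + 1) → Fin (m + 1) := fun i => ⟨L[i] - 1, by have := hb i; omega⟩
    have hf : Function.Injective f := by
      intro i j h
      have := hb i
      have := hb j
      simp only [f, Fin.mk.injEq] at h
      have h5 : L[i] = L[j] := by omega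
      have h6 : L[(i : ℕ)] = L[(j : ℕ)] := h5
      rw [h1.getElem_inj_iff] at h6
      exact Fin.ext h6
    let π := Equiv.ofBijective f (Finite.injective_iff_bijective.1 hf)
    have hπ : ∀ i, (π i : ℕ) + 1 = L[i] := by
      intro i
      have := hb i
      change L[i] - 1 + 1 = L[i]
      omega
    have hw : wd π = L := by
      apply List.ext_getElem
      · simp [wd, hlen]
      · intro i hi hi'
        simp only [wd, List.getElem_ofFn, hπ]
        rfl
    have hF : FirstIs π a := by
      intro i hi
      rw [hπ]
      obtain rfl : i = 0 := Fin.ext hi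
      subst hL
      rfl
    refine ⟨⟨π, ?_, hF⟩, ?_⟩
    · rw [← hw, wd, List.isChain_ofFn] at h3
      intro i j hij hlt
      have := h3 i (by have := j.2; omega)
      have hj : (⟨i + 1, by have := j.2; omega⟩ : Fin (m + 1)) = j := Fin.ext hij
      rw [hj] at this
      exact this (by rw [Fin.lt_def] at hlt; simpa using hlt)
    · rw [hw, ← hL]; rfl

def AA (n a : ℕ) : Set (Perm ℕ) :=
  {σ | (∀ x, 2 * n < x → σ x = x) ∧ (∀ x, RR x (σ x)) ∧ σ (2 * n) = a}

theorem rr_zero {σ : Perm ℕ} (h : ∀ x, RR x (σ x)) : σ 0 = 0 := by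
  by_contra h0
  have := (h 0 (by omega)).1
  simp at this

theorem pp_aa (n a : ℕ) : PP (Finset.Icc 1 (2 * n)) (2 * n) a = AA n a := by
  ext σ
  constructor
  · rintro ⟨h1, h2, h3⟩
    exact ⟨fun x hx => h1 x (by simp; omega), h2, h3⟩
  · rintro ⟨h1, h2, h3⟩
    refine ⟨fun x hx => ?_, h2, h3⟩
    by_cases h0 : x = 0
    · subst h0; exact rr_zero h2
    · exact h1 x (by simp at hx; omega)

theorem gi_aa (n a : ℕ) (hn : 1 ≤ n) (ha : a ≤ 2 * n) :
    Nat.card {π : Perm (Fin (2 * n)) // IsGI π ∧ FirstIs π a} = (AA n a).ncard := by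
  by_cases h0 : a = 0
  · subst h0
    have e1 : AA n 0 = ∅ := by
      ext σ
      simp only [Set.mem_empty_iff_false, iff_false]
      rintro ⟨h1, h2, h3⟩
      have := σ.injective (h3.trans (rr_zero h2).symm)
      omega
    have e2 : IsEmpty {π : Perm (Fin (2 * n)) // IsGI π ∧ FirstIs π 0} := by
      refine ⟨?_⟩
      rintro ⟨π, h1, h2⟩
      have := h2 ⟨0, by omega⟩ rfl
      omega
    rw [e1]; simp
  · obtain ⟨m, hm⟩ : ∃ m, 2 * n = m + 1 := ⟨2 * n - 1, by omega⟩
    obtain ⟨e⟩ := foata m (Finset.Icc 1 (2 * n)) (2 * n) a (by simp [hm]) (by simp; omega)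
      (by intro x hx; simp at hx; omega) (by simp; omega)
    rw [pp_aa n a] at e
    rw [hm] at e ⊢
    obtain ⟨e'⟩ := gi_ll m a
    exact Nat.card_congr (e'.trans e)

theorem fin_perm (n : ℕ) : {σ : Perm ℕ | ∀ x, 2 * n < x → σ x = x}.Finite := by
  have e := Equiv.Perm.subtypeEquivSubtypePerm (fun x : ℕ => x ≤ 2 * n)
  have : Finite {x : ℕ // x ≤ 2 * n} := Set.finite_Iic (2 * n)
  have h2 : Finite {f : Perm ℕ // ∀ a, ¬ a ≤ 2 * n → f a = a} := Finite.of_equiv _ e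
  refine Set.Finite.subset (s := {f : Perm ℕ | ∀ a, ¬ a ≤ 2 * n → f a = a}) h2 ?_
  intro σ h x hx
  exact h x (by omega)

theorem ncard_inv {α β : Type*} {A : Set α} {B : Set β} (f : α → β) (g : β → α)
    (hf : ∀ a ∈ A, f a ∈ B) (hg : ∀ b ∈ B, g b ∈ A) (h1 : ∀ a ∈ A, g (f a) = a)
    (h2 : ∀ b ∈ B, f (g b) = b) : A.ncard = B.ncard :=
  Nat.card_congr ⟨fun a => ⟨f a, hf a a.2⟩, fun b => ⟨g b, hg b b.2⟩,
    fun a => Subtype.ext (h1 a a.2), fun b => Subtype.ext (h2 b b.2)⟩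

def BB (n k : ℕ) : Set (Perm ℕ) := {σ | σ ∈ AA n (2 * k + 2) ∧ σ (2 * k) = 2 * k}

theorem step1 (n k : ℕ) (hk : k < n) :
    (AA n (2 * k + 2)).ncard = (AA n (2 * k)).ncard + (BB n k).ncard := by
  have hfin : (AA n (2 * k + 2)).Finite := (fin_perm n).subset fun σ h => h.1
  have h1 : AA n (2 * k + 2) =
      {σ | σ ∈ AA n (2 * k + 2) ∧ σ (2 * k) ≠ 2 * k} ∪ BB n k := by
    ext σ
    simp only [BB, Set.mem_union, Set.mem_ofPred_eq]
    tauto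
  rw [h1, Set.ncard_union_eq ?_ (hfin.subset fun σ h => h.1) (hfin.subset fun σ h => h.1)]
  · congr 1
    refine ncard_inv (fun σ => swap (2 * k) (2 * k + 2) * σ) (fun σ => swap (2 * k) (2 * k + 2) * σ)
      ?_ ?_ ?_ ?_
    · rintro σ ⟨⟨h1, h2, h3⟩, h4⟩
      refine ⟨?_, ?_, ?_⟩
      · intro x hx
        rw [Perm.mul_apply, h1 x hx, swap_apply_of_ne_of_ne] <;> omega
      · intro x
        have := h2 x
        simp only [RR, Perm.mul_apply, swap_apply_def, Nat.odd_iff, Nat.even_iff] at this ⊢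
        have hx : x = 2 * k → σ x ≠ 2 * k := by rintro rfl; exact h4
        have hy : σ x = 2 * k + 2 → x = 2 * n := by
          intro h; exact σ.injective (h.trans h3.symm)
        split_ifs <;> omega
      · simp [h3]
    · rintro σ ⟨h1, h2, h3⟩
      refine ⟨⟨?_, ?_, ?_⟩, ?_⟩
      · intro x hx
        rw [Perm.mul_apply, h1 x hx, swap_apply_of_ne_of_ne] <;> omega
      · intro x
        have := h2 x
        simp only [RR, Perm.mul_apply, swap_apply_def, Nat.odd_iff, Nat.even_iff] at this ⊢
        have hy : σ x = 2 * k → x = 2 * n := by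
          intro h; exact σ.injective (h.trans h3.symm)
        split_ifs <;> omega
      · simp [h3]
      · have := h2 (2 * k)
        have hy : σ (2 * k) = 2 * k → 2 * k = 2 * n := by
          intro h; exact σ.injective (h.trans h3.symm)
        simp only [RR, Perm.mul_apply, swap_apply_def, Nat.odd_iff, Nat.even_iff] at this ⊢
        split_ifs <;> omega
    · intro σ _; simp [← mul_assoc]
    · intro σ _; simp [← mul_assoc]
  · rw [Set.disjoint_left]
    rintro σ h h'
    exact h.2 h'.2

def TT (N k : ℕ) : Set (Perm ℕ) :=
  {σ | (∀ x, 2 * N < x → σ x = x) ∧ (∀ x, RR x (σ x)) ∧ Even (σ (2 * N)) ∧ 2 * k ≤ σ (2 * N)}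

def TU (n k : ℕ) : Set (Perm ℕ) :=
  {σ | (∀ x, 2 * n < x → σ x = x) ∧ (∀ x, RR x (σ x)) ∧ σ (2 * k) = 2 * k ∧
    σ (2 * k + 1) = 2 * k + 1 ∧ Even (σ (2 * n)) ∧ 2 * k + 2 ≤ σ (2 * n)}

theorem perm_le {σ : Perm ℕ} {m x : ℕ} (h : ∀ x, m < x → σ x = x) (hx : x ≤ m) : σ x ≤ m := by
  by_contra h'
  have := σ.injective (h (σ x) (by omega))
  omega

theorem tt_sum (N k : ℕ) : (TT N k).ncard = ∑ i ∈ Finset.Icc k N, (AA N (2 * i)).ncard := by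
  have h : TT N k = ⋃ i ∈ (Finset.Icc k N : Set ℕ), AA N (2 * i) := by
    ext σ
    simp only [TT, AA, Set.mem_iUnion, Set.mem_ofPred_eq, Finset.coe_Icc, Set.mem_Icc, exists_prop]
    constructor
    · rintro ⟨h1, h2, ⟨r, h3⟩, h4⟩
      have := perm_le h1 le_rfl
      exact ⟨r, by omega, h1, h2, by omega⟩
    · rintro ⟨i, hi, h1, h2, h3⟩
      exact ⟨h1, h2, by simp [h3], by omega⟩
  rw [h, Set.Finite.ncard_biUnion (Finset.finite_toSet _)
    (fun i _ => (fin_perm N).subset fun σ h => h.1), finsum_mem_coe_finset]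
  intro i _ j _ hij
  rw [Function.onFun, Set.disjoint_left]
  rintro σ ⟨_, _, h⟩ ⟨_, _, h'⟩
  omega

def skip (k : ℕ) : ℕ ≃ {y : ℕ // y ≠ 2 * k ∧ y ≠ 2 * k + 1} where
  toFun x := ⟨if x < 2 * k then x else x + 2, by split_ifs <;> omega⟩
  invFun y := if y.1 < 2 * k then y.1 else y.1 - 2
  left_inv x := by
    dsimp only
    split_ifs <;> omega
  right_inv := by
    rintro ⟨y, h1, h2⟩
    ext
    dsimp only
    split_ifs <;> omega

theorem skip_val (k x : ℕ) : (skip k x : ℕ) = if x < 2 * k then x else x + 2 := rfl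

theorem rr_skip (k x y : ℕ) : RR (skip k x) (skip k y) ↔ RR x y := by
  simp only [RR, skip_val, Nat.odd_iff, Nat.even_iff]
  split_ifs <;> omega

theorem tt_tu (N k : ℕ) (hk : k ≤ N) : (TT N k).ncard = (TU (N + 1) k).ncard := by
  have hN : (skip k (2 * N) : ℕ) = 2 * (N + 1) := by
    rw [skip_val]; split_ifs <;> omega
  have hout : ∀ (τ : Perm ℕ) y, ¬ (y ≠ 2 * k ∧ y ≠ 2 * k + 1) → τ.extendDomain (skip k) y = y :=
    fun τ y h => Perm.extendDomain_apply_not_subtype _ _ h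
  have hin : ∀ (τ : Perm ℕ) x, τ.extendDomain (skip k) (skip k x) = skip k (τ x) :=
    fun τ x => Perm.extendDomain_apply_image _ _ _
  have hcase : ∀ y : ℕ, (y = 2 * k ∨ y = 2 * k + 1) ∨ ∃ x, y = skip k x := by
    intro y
    by_cases h : y ≠ 2 * k ∧ y ≠ 2 * k + 1
    · right
      exact ⟨(skip k).symm ⟨y, h⟩, by simp⟩
    · left; omega
  have himg : TU (N + 1) k = (fun τ : Perm ℕ => τ.extendDomain (skip k)) '' TT N k := by
    ext σ
    constructor
    · rintro ⟨h1, h2, h3, h4, h5, h6⟩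
      have hp : ∀ y, (σ y ≠ 2 * k ∧ σ y ≠ 2 * k + 1) ↔ (y ≠ 2 * k ∧ y ≠ 2 * k + 1) := by
        intro y
        have i1 : σ y = 2 * k ↔ y = 2 * k := by
          rw [← σ.injective.eq_iff (a := y) (b := 2 * k), h3]
        have i2 : σ y = 2 * k + 1 ↔ y = 2 * k + 1 := by
          rw [← σ.injective.eq_iff (a := y) (b := 2 * k + 1), h4]
        rw [Ne, Ne, i1, i2]
      let τ : Perm ℕ := (skip k).permCongr.symm (σ.subtypePerm hp)
      have hτ : ∀ x, (skip k (τ x) : ℕ) = σ (skip k x) := by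
        intro x
        simp [τ, Equiv.permCongr_symm]
      refine ⟨τ, ⟨?_, ?_, ?_⟩, ?_⟩
      · intro x hx
        have := hτ x
        rw [h1] at this
        · exact (skip k).injective (Subtype.ext this)
        · rw [skip_val]; split_ifs <;> omega
      · intro x
        rw [← rr_skip k, hτ]
        exact h2 _
      · have := hτ (2 * N)
        rw [hN] at this
        rw [← this, skip_val] at h5 h6
        rw [Nat.even_iff] at h5 ⊢
        split_ifs at h5 h6 <;> omega
      · ext y
        rcases hcase y with h | ⟨x, rfl⟩
        · dsimp only
          rw [hout _ _ (by omega)]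
          rcases h with rfl | rfl
          · exact h3.symm
          · exact h4.symm
        · dsimp only
          rw [hin, hτ]
    · rintro ⟨τ, ⟨h1, h2, h3, h4⟩, rfl⟩
      refine ⟨?_, ?_, hout _ _ (by omega), hout _ _ (by omega), ?_⟩
      · intro y hy
        rcases hcase y with h | ⟨x, rfl⟩
        · exact hout _ _ (by omega)
        · dsimp only
          rw [hin, h1]
          rw [skip_val] at hy
          split_ifs at hy <;> omega
      · intro y
        rcases hcase y with h | ⟨x, rfl⟩
        · dsimp only
          rw [hout _ _ (by omega)]
          intro h; omega
        · dsimp only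
          rw [hin, rr_skip]
          exact h2 x
      · dsimp only
        rw [← hN, hin, skip_val]
        rw [Nat.even_iff] at h3 ⊢
        split_ifs <;> omega
  rw [himg, Set.ncard_image_of_injective]
  exact Perm.extendDomainHom_injective (skip k)

/-- pairs -/
def RS (n k : ℕ) : Set (Perm ℕ) :=
  {σ | σ ∈ AA n (2 * k + 2) ∧ σ (2 * k) = 2 * k ∧ σ (2 * k + 1) = 2 * k + 1}

theorem cross (ρ : Perm ℕ) (u : ℕ) :
    Nonempty ({x : ℕ // u ≤ x ∧ ρ x < u} ≃ {x : ℕ // x < u ∧ u ≤ ρ x}) := by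
  let I := Finset.range u
  let J := I.image ρ
  have hc : (J \ I).card = (I \ J).card := by
    apply Finset.card_sdiff_comm
    exact Finset.card_image_of_injective _ ρ.injective
  have e0 : {x // x ∈ J \ I} ≃ {x // x ∈ I \ J} := Finset.equivOfCardEq hc
  have e1 : {x : ℕ // u ≤ x ∧ ρ x < u} ≃ {x // x ∈ I \ J} := by
    refine ρ.subtypeEquiv ?_
    intro x
    simp [I, J]
    omega
  have e2 : {x : ℕ // x < u ∧ u ≤ ρ x} ≃ {x // x ∈ J \ I} := by
    refine ρ.subtypeEquiv ?_
    intro x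
    simp [I, J]
  exact ⟨e1.trans (e0.symm.trans e2.symm)⟩

theorem cross_pairs (R : Set (Perm ℕ)) (u : ℕ) :
    {p : Perm ℕ × ℕ | p.1 ∈ R ∧ u ≤ p.2 ∧ p.1 p.2 < u}.ncard =
    {p : Perm ℕ × ℕ | p.1 ∈ R ∧ p.2 < u ∧ u ≤ p.1 p.2}.ncard := by
  refine Nat.card_congr ⟨fun p => ⟨(p.1.1, ((cross p.1.1 u).some ⟨p.1.2, p.2.2⟩).1), p.2.1,
    ((cross p.1.1 u).some ⟨p.1.2, p.2.2⟩).2⟩,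
    fun p => ⟨(p.1.1, ((cross p.1.1 u).some.symm ⟨p.1.2, p.2.2⟩).1), p.2.1,
    ((cross p.1.1 u).some.symm ⟨p.1.2, p.2.2⟩).2⟩, ?_, ?_⟩
  · rintro ⟨⟨ρ, x⟩, h⟩
    simp
  · rintro ⟨⟨ρ, x⟩, h⟩
    simp

theorem step2 (n k : ℕ) (hk : k < n) :
    {σ | σ ∈ BB n k ∧ 2 * k + 1 < σ (2 * k + 1)}.ncard =
    {σ | σ ∈ TU n k ∧ 2 * k + 2 < σ (2 * n) ∧ 2 * k + 2 ≤ σ.symm (2 * k + 2)}.ncard := by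
  set u := 2 * k + 1 with hu
  refine ncard_inv (fun σ => swap u (u + 1) * σ * swap u (2 * n))
    (fun σ => swap u (u + 1) * σ * swap u (2 * n)) ?_ ?_ ?_ ?_
  · rintro σ ⟨⟨⟨h1, h2, h3⟩, h4⟩, h5⟩
    have hn := perm_le h1 (x := u) (by omega)
    have hu1 : σ u ≠ 2 * k + 2 := fun h => by
      have := σ.injective (h.trans h3.symm); omega
    have hu2 := h2 u h5
    rw [Nat.odd_iff, Nat.even_iff] at hu2
    have v1 : (swap u (u + 1) * σ * swap u (2 * n)) (2 * n) = σ u := by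
      simp only [Perm.mul_apply, swap_apply_right]
      rw [swap_apply_of_ne_of_ne] <;> omega
    have v2 : (swap u (u + 1) * σ * swap u (2 * n)) u = u := by
      simp only [Perm.mul_apply, swap_apply_left, h3]
      exact swap_apply_right _ _
    have v3 : ∀ x, x ≠ u → x ≠ 2 * n →
        (swap u (u + 1) * σ * swap u (2 * n)) x = if σ x = u then u + 1 else σ x := by
      intro x hx hx'
      have : σ x ≠ u + 1 := fun h => hx' (σ.injective (h.trans h3.symm))
      simp only [Perm.mul_apply, swap_apply_of_ne_of_ne hx hx', swap_apply_def, this, if_false]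
    have v4 : ∀ x, σ x = u → u < x := by
      intro x hx
      have := h2 x
      simp only [RR, hx, Nat.odd_iff, Nat.even_iff] at this
      have : x ≠ u := by rintro rfl; omega
      omega
    refine ⟨⟨?_, ?_, ?_, v2, ?_, ?_⟩, ?_, ?_⟩
    · intro x hx
      rw [v3 x (by omega) (by omega), h1 x hx, if_neg (by omega)]
    · intro x
      by_cases e1 : x = u
      · subst e1; rw [v2]; intro h; omega
      · by_cases e2 : x = 2 * n
        · subst e2; rw [v1]; intro h; omega
        · rw [v3 x e1 e2]
          have a1 := h2 x
          have a2 := v4 x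
          simp only [RR, Nat.odd_iff, Nat.even_iff] at a1 ⊢
          split_ifs <;> omega
    · rw [v3 _ (by omega) (by omega), h4, if_neg (by omega)]
    · rw [v1, Nat.even_iff]; exact hu2.2
    · rw [v1]; omega
    · rw [v1]; omega
    · obtain ⟨x, hx⟩ := σ.surjective u
      have := v4 x hx
      have h6 : x ≠ 2 * n := by rintro rfl; omega
      have h7 := v3 x (by omega) h6
      rw [if_pos hx] at h7
      have h8 : (swap u (u + 1) * σ * swap u (2 * n)).symm (2 * k + 2) = x := by
        rw [symm_apply_eq, h7]
      rw [h8]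
      omega
  · rintro σ ⟨⟨h1, h2, h3, h4, h5, _⟩, h6, h7⟩
    rw [← hu] at h4
    have hn := perm_le h1 (x := 2 * n) le_rfl
    have v1 : (swap u (u + 1) * σ * swap u (2 * n)) (2 * n) = 2 * k + 2 := by
      simp only [Perm.mul_apply, swap_apply_right, h4]
      exact swap_apply_left _ _
    have v2 : (swap u (u + 1) * σ * swap u (2 * n)) u = σ (2 * n) := by
      simp only [Perm.mul_apply, swap_apply_left]
      rw [swap_apply_of_ne_of_ne] <;> omega
    have v3 : ∀ x, x ≠ u → x ≠ 2 * n →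
        (swap u (u + 1) * σ * swap u (2 * n)) x = if σ x = u + 1 then u else σ x := by
      intro x hx hx'
      have : σ x ≠ u := fun h => hx (σ.injective (h.trans h4.symm))
      simp only [Perm.mul_apply, swap_apply_of_ne_of_ne hx hx', swap_apply_def, this, if_false]
    have v4 : ∀ x, σ x = u + 1 → u < x := by
      intro x hx
      rw [show 2 * k + 2 = u + 1 by omega, ← hx, symm_apply_apply] at h7
      omega
    refine ⟨⟨⟨?_, ?_, v1⟩, ?_⟩, ?_⟩
    · intro x hx
      rw [v3 x (by omega) (by omega), h1 x hx, if_neg (by omega)]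
    · intro x
      by_cases e1 : x = u
      · subst e1; rw [v2]; intro h; exact ⟨by rw [Nat.odd_iff]; omega, h5⟩
      · by_cases e2 : x = 2 * n
        · subst e2; rw [v1]; intro h; omega
        · rw [v3 x e1 e2]
          have a1 := h2 x
          have a2 := v4 x
          simp only [RR, Nat.odd_iff, Nat.even_iff] at a1 ⊢
          split_ifs <;> omega
    · rw [v3 _ (by omega) (by omega), h3, if_neg (by omega)]
    · change u < (swap u (u + 1) * σ * swap u (2 * n)) u
      rw [v2]; omega
  · intro σ _
    ext x
    simp
  · intro σ _
    ext x
    simp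

theorem step3 (n k : ℕ) (hk : k < n) :
    {σ | σ ∈ BB n k ∧ σ (2 * k + 1) < 2 * k + 1}.ncard =
    {σ | σ ∈ TU n k ∧ 2 * k + 2 < σ (2 * n) ∧ σ.symm (2 * k + 2) < 2 * k + 2}.ncard := by
  set u := 2 * k + 1 with hu
  trans {p : Perm ℕ × ℕ | p.1 ∈ RS n k ∧ u ≤ p.2 ∧ p.1 p.2 < u}.ncard
  · refine ncard_inv (fun σ => (σ * swap (σ.symm u) u, σ.symm u)) (fun p => p.1 * swap p.2 u)
      ?_ ?_ ?_ ?_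
    · rintro σ ⟨⟨⟨h1, h2, h3⟩, h4⟩, h5⟩
      obtain ⟨y, hy⟩ := σ.surjective u
      have hy' : σ.symm u = y := by rw [← hy, symm_apply_apply]
      have hyu : y ≠ u := by rintro rfl; omega
      have hyn : y ≠ 2 * n := by rintro rfl; omega
      have hyl : u < y := by
        have := h2 y
        simp only [RR, hy, Nat.odd_iff, Nat.even_iff] at this
        omega
      have hyl' : y ≤ 2 * n := by
        by_contra h
        have := h1 y (by omega)
        omega
      have hu5 : σ u < u := h5
      simp only [hy', Set.mem_ofPred_eq, RS, AA]
      have v1 : (σ * swap y u) y = σ u := by simp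
      have v2 : (σ * swap y u) u = u := by simp [hy]
      have v3 : ∀ x, x ≠ y → x ≠ u → (σ * swap y u) x = σ x := by
        intro x e1 e2
        rw [Perm.mul_apply, swap_apply_of_ne_of_ne e1 e2]
      refine ⟨⟨⟨?_, ?_, ?_⟩, ?_, v2⟩, by omega, ?_⟩
      · intro x hx
        rw [v3 x (by omega) (by omega), h1 x hx]
      · intro x
        by_cases e1 : x = y
        · subst e1; rw [v1]; intro h; omega
        · by_cases e2 : x = u
          · subst e2; rw [v2]; intro h; omega
          · rw [v3 x e1 e2]; exact h2 x
      · rw [v3 _ (by omega) (by omega), h3]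
      · rw [v3 _ (by omega) (by omega), h4]
      · rw [v1]; omega
    · rintro ⟨σ, y⟩ ⟨⟨⟨h1, h2, h3⟩, h4, h5⟩, h6, h7⟩
      simp only at h1 h2 h3 h4 h5 h6 h7
      rw [← hu] at h5
      have hyu : y ≠ u := by rintro rfl; omega
      have hyn : y ≠ 2 * n := by rintro rfl; omega
      have hyl' : y ≤ 2 * n := by
        by_contra h
        have := h1 y (by omega)
        omega
      have v1 : (σ * swap y u) y = u := by simp [h5]
      have v2 : (σ * swap y u) u = σ y := by simp
      have v3 : ∀ x, x ≠ y → x ≠ u → (σ * swap y u) x = σ x := by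
        intro x e1 e2
        rw [Perm.mul_apply, swap_apply_of_ne_of_ne e1 e2]
      refine ⟨⟨⟨?_, ?_, ?_⟩, ?_⟩, ?_⟩
      · intro x hx
        rw [v3 x (by omega) (by omega), h1 x hx]
      · intro x
        by_cases e1 : x = y
        · subst e1; rw [v1]; intro h; omega
        · by_cases e2 : x = u
          · subst e2; rw [v2]; intro h; omega
          · rw [v3 x e1 e2]; exact h2 x
      · rw [v3 _ (by omega) (by omega), h3]
      · rw [v3 _ (by omega) (by omega), h4]
      · change (σ * swap y u) u < u
        rw [v2]; omega
    · intro σ _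
      simp [mul_assoc]
    · rintro ⟨σ, y⟩ ⟨⟨⟨h1, h2, h3⟩, h4, h5⟩, h6, h7⟩
      simp only at h5
      rw [← hu] at h5
      have hs : (σ * swap y u).symm u = y := by
        rw [symm_apply_eq]; simp [h5]
      simp only [hs]
      simp [mul_assoc]
  rw [cross_pairs]
  · symm
    refine ncard_inv (fun σ => (σ * swap (σ.symm (2 * k + 2)) (2 * n), σ.symm (2 * k + 2)))
      (fun p => p.1 * swap p.2 (2 * n)) ?_ ?_ ?_ ?_
    · rintro σ ⟨⟨h1, h2, h3, h4, h5, _⟩, h6, h7⟩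
      rw [← hu] at h4
      obtain ⟨y, hy⟩ := σ.surjective (2 * k + 2)
      have hy' : σ.symm (2 * k + 2) = y := by rw [← hy, symm_apply_apply]
      rw [hy'] at h7
      have hyu : y ≠ u := by rintro rfl; omega
      have hyn : y ≠ 2 * n := by rintro rfl; omega
      have hyo := h2 y
      simp only [RR, hy, Nat.odd_iff, Nat.even_iff] at hyo
      simp only [hy', Set.mem_ofPred_eq, RS, AA]
      have v1 : (σ * swap y (2 * n)) y = σ (2 * n) := by simp
      have v2 : (σ * swap y (2 * n)) (2 * n) = 2 * k + 2 := by simp [hy]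
      have v3 : ∀ x, x ≠ y → x ≠ 2 * n → (σ * swap y (2 * n)) x = σ x := by
        intro x e1 e2
        rw [Perm.mul_apply, swap_apply_of_ne_of_ne e1 e2]
      refine ⟨⟨⟨?_, ?_, v2⟩, ?_, ?_⟩, by omega, ?_⟩
      · intro x hx
        rw [v3 x (by omega) (by omega), h1 x hx]
      · intro x
        by_cases e1 : x = y
        · subst e1; rw [v1]; intro h; exact ⟨by rw [Nat.odd_iff]; omega, h5⟩
        · by_cases e2 : x = 2 * n
          · subst e2; rw [v2]; intro h; omega
          · rw [v3 x e1 e2]; exact h2 x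
      · rw [v3 _ (by omega) (by omega), h3]
      · rw [← hu, v3 _ (by omega) (by omega), h4]
      · rw [v1]; omega
    · rintro ⟨σ, y⟩ ⟨⟨⟨h1, h2, h3⟩, h4, h5⟩, h6, h7⟩
      simp only at h1 h2 h3 h4 h5 h6 h7
      rw [← hu] at h5
      have hyv : σ y ≠ 2 * k + 2 := fun h => by
        have := σ.injective (h.trans h3.symm); omega
      have hyu : σ y ≠ u := fun h => by
        have := σ.injective (h.trans h5.symm); omega
      have hyo := h2 y (by omega)
      have hyo1 := Nat.odd_iff.1 hyo.1
      have v1 : (σ * swap y (2 * n)) y = 2 * k + 2 := by simp [h3]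
      have v2 : (σ * swap y (2 * n)) (2 * n) = σ y := by simp
      have v3 : ∀ x, x ≠ y → x ≠ 2 * n → (σ * swap y (2 * n)) x = σ x := by
        intro x e1 e2
        rw [Perm.mul_apply, swap_apply_of_ne_of_ne e1 e2]
      have hl := perm_le h1 (x := y) (by omega)
      refine ⟨⟨?_, ?_, ?_, ?_, ?_, ?_⟩, ?_, ?_⟩
      · intro x hx
        rw [v3 x (by omega) (by omega), h1 x hx]
      · intro x
        by_cases e1 : x = y
        · subst e1; rw [v1]; intro h; exact ⟨hyo.1, by rw [Nat.even_iff]; omega⟩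
        · by_cases e2 : x = 2 * n
          · subst e2; rw [v2]; intro h; omega
          · rw [v3 x e1 e2]; exact h2 x
      · rw [v3 _ (by omega) (by omega), h4]
      · rw [← hu, v3 _ (by omega) (by omega), h5]
      · rw [v2]; exact hyo.2
      · rw [v2]; omega
      · rw [v2]; omega
      · change (σ * swap y (2 * n)).symm (2 * k + 2) < _
        rw [← v1, symm_apply_apply]; omega
    · intro σ _
      simp [mul_assoc]
    · rintro ⟨σ, y⟩ ⟨⟨⟨h1, h2, h3⟩, h4, h5⟩, h6, h7⟩
      simp only at h3
      have hs : (σ * swap y (2 * n)).symm (2 * k + 2) = y := by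
        rw [symm_apply_eq]; simp [h3]
      simp only [hs]
      simp [mul_assoc]

theorem split3 {α : Type*} {S : Set α} (hS : S.Finite) (p q r : α → Prop)
    (h : ∀ x ∈ S, p x ∨ q x ∨ r x) (hpq : ∀ x ∈ S, p x → ¬ q x) (hpr : ∀ x ∈ S, p x → ¬ r x)
    (hqr : ∀ x ∈ S, q x → ¬ r x) :
    S.ncard = {x | x ∈ S ∧ p x}.ncard + ({x | x ∈ S ∧ q x}.ncard + {x | x ∈ S ∧ r x}.ncard) := by
  have f : ∀ p : α → Prop, {x | x ∈ S ∧ p x}.Finite := fun p => hS.subset fun x h => h.1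
  rw [← Set.ncard_union_eq _ (f q) (f r), ← Set.ncard_union_eq _ (f p) ((f q).union (f r))]
  · congr 1
    ext x
    have := h x
    simp only [Set.mem_union, Set.mem_ofPred_eq]
    tauto
  · rw [Set.disjoint_left]
    rintro x ⟨h1, h2⟩ (h3 | h3)
    · exact hpq x h1 h2 h3.2
    · exact hpr x h1 h2 h3.2
  · rw [Set.disjoint_left]
    rintro x ⟨h1, h2⟩ h3
    exact hqr x h1 h2 h3.2

theorem bb_tu (n k : ℕ) (hk : k < n) : (BB n k).ncard = (TU n k).ncard := by
  rw [split3 (S := BB n k) ((fin_perm n).subset fun σ h => h.1.1)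
    (fun σ => σ (2 * k + 1) = 2 * k + 1) (fun σ => 2 * k + 1 < σ (2 * k + 1))
    (fun σ => σ (2 * k + 1) < 2 * k + 1) (fun σ _ => by omega) (fun σ _ => by omega)
    (fun σ _ => by omega) (fun σ _ => by omega),
    split3 (S := TU n k) ((fin_perm n).subset fun σ h => h.1)
    (fun σ => σ (2 * n) = 2 * k + 2)
    (fun σ => 2 * k + 2 < σ (2 * n) ∧ 2 * k + 2 ≤ σ.symm (2 * k + 2))
    (fun σ => 2 * k + 2 < σ (2 * n) ∧ σ.symm (2 * k + 2) < 2 * k + 2)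
    (fun σ h => by have := h.2.2.2.2.2; omega) (fun σ _ => by omega)
    (fun σ _ => by omega) (fun σ _ => by omega), step2 n k hk, step3 n k hk]
  congr 2
  ext σ
  constructor
  · rintro ⟨⟨⟨h1, h2, h3⟩, h4⟩, h5⟩
    exact ⟨⟨h1, h2, h4, h5, by rw [h3, Nat.even_iff]; omega, by omega⟩, h3⟩
  · rintro ⟨⟨h1, h2, h3, h4, h5, h6⟩, h7⟩
    exact ⟨⟨⟨h1, h2, h7⟩, h3⟩, h4⟩

end helpers

/-- For all `n ≥ 2` and `0 ≤ k < n`,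
`|G^I_{2n,2k+2}| = |G^I_{2n,2k}| + Σ_{i=k}^{n-1} |G^I_{2n-2,2i}|`
(with `|G^I_{2m,0}| = 0` by convention: no first letter can equal `0`). -/
theorem card_GI_first_even_rec (n k : ℕ) (hn : 2 ≤ n) (hk : k < n) :
    Nat.card {π : Equiv.Perm (Fin (2 * n)) // IsGI π ∧ FirstIs π (2 * k + 2)} =
      Nat.card {π : Equiv.Perm (Fin (2 * n)) // IsGI π ∧ FirstIs π (2 * k)} +
      ∑ i ∈ Finset.Icc k (n - 1),
        Nat.card {π : Equiv.Perm (Fin (2 * n - 2)) // IsGI π ∧ FirstIs π (2 * i)} := by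
  obtain ⟨N, rfl⟩ : ∃ N, n = N + 1 := ⟨n - 1, by omega⟩
  rw [gi_aa (N + 1) _ (by omega) (by omega), gi_aa (N + 1) _ (by omega) (by omega),
    step1 _ _ hk, bb_tu _ _ hk, ← tt_tu N k (by omega), tt_sum]
  congr 1
  refine Finset.sum_congr rfl fun i hi => ?_
  rw [Finset.mem_Icc] at hi
  exact (gi_aa N (2 * i) (by omega) (by omega)).symm
end

section
/- For all n ≥ 2 and all 3 ≤ k ≤ 2n, the number of permutations π ∈ G^I_{2n} with π_1 = k and last letter π_{2n} = 2 equals the number of permutations π ∈ G^I_{2n} with π_1 = k and π_{2n} ≠ 2; consequently |G^I_{2n,k}| is even for every k ≥ 3. -/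
/-- The last letter of the one-line notation of `π` is `k`. -/
def LastIs {m : ℕ} (π : Equiv.Perm (Fin m)) (k : ℕ) : Prop :=
  ∀ i : Fin m, (i : ℕ) + 1 = m → (π i : ℕ) + 1 = k

/-- The position rotation `p ↦ m-1`, `i ↦ i-1` for `i > p`. -/
def rotPos {m : ℕ} (p : Fin m) : Equiv.Perm (Fin m) where
  toFun i := if (i : ℕ) < p then i else if (i : ℕ) = p then ⟨m - 1, by have := p.2; omega⟩
    else ⟨(i : ℕ) - 1, by omega⟩
  invFun i := if (i : ℕ) < p then i else if h : (i : ℕ) = m - 1 then p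
    else ⟨(i : ℕ) + 1, by omega⟩
  left_inv i := by
    apply Fin.ext
    have := p.2
    have := i.2
    grind
  right_inv i := by
    apply Fin.ext
    have := p.2
    have := i.2
    grind

theorem rot_lt {m : ℕ} (p i : Fin m) (h : (i : ℕ) < p) : rotPos p i = i := by
  simp only [rotPos, Equiv.coe_fn_mk, if_pos h]

theorem rot_eq {m : ℕ} (p l : Fin m) (hl : (l : ℕ) + 1 = m) : rotPos p p = l := by
  apply Fin.ext
  simp [rotPos]; omega

theorem rot_gt {m : ℕ} (p i j : Fin m) (h : (p : ℕ) ≤ i) (hj : (i : ℕ) + 1 = j) :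
    rotPos p j = i := by
  apply Fin.ext
  have h1 : ¬ (j : ℕ) < p := by omega
  have h2 : ¬ (j : ℕ) = p := by omega
  simp only [rotPos, Equiv.coe_fn_mk, if_neg h1, if_neg h2]; omega

theorem inv_lt {m : ℕ} (p i : Fin m) (h : (i : ℕ) < p) : (rotPos p)⁻¹ i = i := by
  rw [Equiv.Perm.inv_eq_iff_eq, rot_lt p i h]

theorem inv_last {m : ℕ} (p l : Fin m) (hl : (l : ℕ) + 1 = m) : (rotPos p)⁻¹ l = p := by
  rw [Equiv.Perm.inv_eq_iff_eq, rot_eq p l hl]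

theorem inv_ge {m : ℕ} (p i j : Fin m) (h : (p : ℕ) ≤ i) (hj : (i : ℕ) + 1 = j) :
    (rotPos p)⁻¹ i = j := by
  rw [Equiv.Perm.inv_eq_iff_eq, rot_gt p i j h hj]

theorem fwd_GI {m : ℕ} (π : Equiv.Perm (Fin m)) (p l : Fin m) (hl : (l : ℕ) + 1 = m)
    (h : IsGI π) (hp : (π p : ℕ) = 0) (h2 : (π l : ℕ) = 1) : IsGI (π * rotPos p) := by
  intro i j hij hlt
  simp only [Equiv.Perm.mul_apply] at hlt ⊢
  rcases lt_trichotomy (j : ℕ) p with hj | hj | hj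
  · rw [rot_lt p i (by omega), rot_lt p j hj] at hlt ⊢
    exact h i j hij hlt
  · obtain rfl : j = p := Fin.ext hj
    rw [rot_lt j i (by omega), rot_eq j l hl, Fin.lt_def, h2] at hlt
    have : π i = π j := Fin.ext (by omega)
    have := congrArg Fin.val (π.injective this)
    omega
  · rcases lt_or_eq_of_le (show (p : ℕ) ≤ i by omega) with hi | hi
    · have e1 := rot_gt p ⟨(i : ℕ) - 1, by omega⟩ i (by simp; omega) (by simp; omega)
      have e2 := rot_gt p i j (by omega) hij
      rw [e1, e2] at hlt ⊢
      exact h _ _ (by simp; omega) hlt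
    · obtain rfl : p = i := Fin.ext hi
      rw [rot_eq p l hl, rot_gt p p j le_rfl hij, Fin.lt_def] at hlt
      omega

theorem next_zero {m : ℕ} (π : Equiv.Perm (Fin m)) (q r : Fin m) (hr : (q : ℕ) + 1 = r)
    (h : IsGI π) (hq : (π q : ℕ) = 1) : (π r : ℕ) = 0 := by
  by_contra hne
  have hne1 : (π r : ℕ) ≠ 1 := by
    intro h1
    have := congrArg Fin.val (π.injective (Fin.ext (h1.trans hq.symm)))
    omega
  have := (h q r hr (by rw [Fin.lt_def]; omega)).1
  rw [hq] at this
  exact absurd this (by decide)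

theorem bwd_GI {m : ℕ} (π : Equiv.Perm (Fin m)) (q : Fin m) (hql : (q : ℕ) + 1 < m)
    (h : IsGI π) (hq : (π q : ℕ) = 1) : IsGI (π * (rotPos q)⁻¹) := by
  intro i j hij hlt
  simp only [Equiv.Perm.mul_apply] at hlt ⊢
  rcases lt_trichotomy (j : ℕ) q with hj | hj | hj
  · rw [inv_lt q i (by omega), inv_lt q j hj] at hlt ⊢
    exact h i j hij hlt
  · obtain rfl : j = q := Fin.ext hj
    have e := inv_ge j j ⟨(j : ℕ) + 1, hql⟩ le_rfl rfl
    have e0 := next_zero π j ⟨(j : ℕ) + 1, hql⟩ rfl h hq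
    rw [e, Fin.lt_def] at hlt
    omega
  · have e := inv_ge q i j (by omega) hij
    by_cases hjl : (j : ℕ) + 1 = m
    · have e1 := inv_last q j hjl
      rw [e, e1] at hlt ⊢
      rw [Fin.lt_def] at hlt
      have : (π j : ℕ) = 0 := by omega
      rw [this, hq]
      decide
    · have e1 := inv_ge q j ⟨(j : ℕ) + 1, by omega⟩ (by omega) rfl
      rw [e, e1] at hlt ⊢
      exact h _ _ rfl hlt

theorem card_eq_aux (m k : ℕ) (hk3 : 3 ≤ k) (hm : 2 ≤ m) :
    Nat.card {π : Equiv.Perm (Fin m) // IsGI π ∧ FirstIs π k ∧ LastIs π 2} =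
      Nat.card {π : Equiv.Perm (Fin m) // IsGI π ∧ FirstIs π k ∧ ¬LastIs π 2} := by
  let z : Fin m := ⟨0, by omega⟩
  let o : Fin m := ⟨1, by omega⟩
  let l : Fin m := ⟨m - 1, by omega⟩
  have hl : (l : ℕ) + 1 = m := by simp only [l]; omega
  have hz : (z : ℕ) = 0 := rfl
  have ho : (o : ℕ) = 1 := rfl
  have lastv : ∀ π : Equiv.Perm (Fin m), LastIs π 2 ↔ π l = o := by
    intro π
    constructor
    · intro h
      have := h l hl
      exact Fin.ext (by omega)
    · intro h i hi
      obtain rfl : i = l := Fin.ext (by omega)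
      rw [h]
  have pos : ∀ (π : Equiv.Perm (Fin m)) (v : Fin m), FirstIs π k → (v : ℕ) ≤ 1 →
      0 < ((π⁻¹ v : Fin m) : ℕ) := by
    intro π v hf hv
    by_contra h0
    have := hf (π⁻¹ v) (by omega)
    rw [Equiv.Perm.coe_inv, Equiv.apply_symm_apply] at this
    omega
  have qlt : ∀ (π : Equiv.Perm (Fin m)), ¬ LastIs π 2 → ((π⁻¹ o : Fin m) : ℕ) + 1 < m := by
    intro π h
    by_contra hc
    apply h
    rw [lastv]
    have : π⁻¹ o = l := Fin.ext (by omega)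
    rw [← this, Equiv.Perm.coe_inv, Equiv.apply_symm_apply]
  have key1 : ∀ (π : Equiv.Perm (Fin m)), LastIs π 2 →
      (π * rotPos (π⁻¹ z))⁻¹ o = π⁻¹ z := by
    intro π h
    rw [Equiv.Perm.inv_eq_iff_eq, Equiv.Perm.mul_apply, rot_eq _ l hl, (lastv π).1 h]
  have key2 : ∀ (π : Equiv.Perm (Fin m)), IsGI π → ¬ LastIs π 2 →
      (π * (rotPos (π⁻¹ o))⁻¹)⁻¹ z = π⁻¹ o := by
    intro π hg h
    rw [Equiv.Perm.inv_eq_iff_eq, Equiv.Perm.mul_apply,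
      inv_ge _ _ ⟨((π⁻¹ o : Fin m) : ℕ) + 1, qlt π h⟩ le_rfl rfl]
    exact (Fin.ext (next_zero π (π⁻¹ o) _ rfl hg (by simp [ho]))).symm
  refine Nat.card_congr
    { toFun := fun π => ⟨π.1 * rotPos (π.1⁻¹ z), ?_, ?_, ?_⟩
      invFun := fun π => ⟨π.1 * (rotPos (π.1⁻¹ o))⁻¹, ?_, ?_, ?_⟩
      left_inv := ?_
      right_inv := ?_ }
  · obtain ⟨π, h1, h2, h3⟩ := π
    exact fwd_GI π _ l hl h1 (by simp [hz]) (by rw [(lastv π).1 h3])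
  · obtain ⟨π, h1, h2, h3⟩ := π
    intro i hi
    have := pos π z h2 (by omega)
    dsimp only
    rw [Equiv.Perm.mul_apply, rot_lt _ i (by omega)]
    exact h2 i hi
  · obtain ⟨π, h1, h2, h3⟩ := π
    dsimp only
    intro hc
    have h4 := (lastv _).1 hc
    rw [← Equiv.Perm.eq_inv_iff_eq, key1 π h3, Equiv.Perm.eq_inv_iff_eq, (lastv π).1 h3] at h4
    have := congrArg Fin.val h4
    omega
  · obtain ⟨π, h1, h2, h3⟩ := π
    exact bwd_GI π _ (qlt π h3) h1 (by simp [ho])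
  · obtain ⟨π, h1, h2, h3⟩ := π
    intro i hi
    have := pos π o h2 (by omega)
    dsimp only
    rw [Equiv.Perm.mul_apply, inv_lt _ i (by omega)]
    exact h2 i hi
  · obtain ⟨π, h1, h2, h3⟩ := π
    dsimp only
    rw [lastv, Equiv.Perm.mul_apply, inv_last _ l hl, Equiv.Perm.coe_inv, Equiv.apply_symm_apply]
  · rintro ⟨π, h1, h2, h3⟩
    apply Subtype.ext
    dsimp only
    rw [key1 π h3, mul_inv_cancel_right]
  · rintro ⟨π, h1, h2, h3⟩
    apply Subtype.ext
    dsimp only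
    rw [key2 π h1 h3, inv_mul_cancel_right]

/-- For all `n ≥ 2` and `3 ≤ k ≤ 2n`, the number of `π ∈ G^I_{2n}` with
`π_1 = k` and `π_{2n} = 2` equals the number with `π_1 = k` and `π_{2n} ≠ 2`;
consequently `|G^I_{2n,k}|` is even. -/
theorem card_GI_last_two_eq_last_ne_two (n k : ℕ) (hn : 2 ≤ n) (hk3 : 3 ≤ k)
    (hk : k ≤ 2 * n) :
    Nat.card {π : Equiv.Perm (Fin (2 * n)) // IsGI π ∧ FirstIs π k ∧ LastIs π 2} =
      Nat.card {π : Equiv.Perm (Fin (2 * n)) // IsGI π ∧ FirstIs π k ∧ ¬LastIs π 2} ∧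
    Even (Nat.card {π : Equiv.Perm (Fin (2 * n)) // IsGI π ∧ FirstIs π k}) := by
  classical
  have h := card_eq_aux (2 * n) k hk3 (by omega)
  refine ⟨h, ?_⟩
  simp only [Nat.card_eq_fintype_card, Fintype.card_subtype, ← and_assoc] at h ⊢
  rw [← Finset.card_filter_add_card_filter_not (fun π => LastIs π 2), Finset.filter_filter,
    Finset.filter_filter, h]
  exact ⟨_, rfl⟩
end

section
/- For all n ≥ 2 and all 0 ≤ k ≤ n−1, the Seidel triangle satisfies the recurrence S(2n, n−k) = S(2n, n+1−k) + Σ_{i=k}^{n−1} S(2n−2, n−i). -/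
/-- For all `n ≥ 2` and `0 ≤ k ≤ n-1`, the Seidel triangle satisfies
`S(2n, n-k) = S(2n, n+1-k) + Σ_{i=k}^{n-1} S(2n-2, n-i)`. -/
theorem seidel_recurrence
    (S : ℕ → ℕ → ℕ)
    (hS1 : S 1 1 = 1)
    (hS0 : ∀ r, 1 ≤ r → S r 0 = 0)
    (hStop : ∀ r k, 1 ≤ r → r + 1 < 2 * k → S r k = 0)
    (hSeven : ∀ m k, 1 ≤ m → 1 ≤ k →
      S (2 * m) k = S (2 * m - 1) k + S (2 * m) (k + 1))
    (hSodd : ∀ m k, 1 ≤ m → 1 ≤ k → k ≤ m + 1 →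
      S (2 * m + 1) k = S (2 * m) k + S (2 * m + 1) (k - 1))
    (n k : ℕ) (hn : 2 ≤ n) (hk : k ≤ n - 1) :
    S (2 * n) (n - k) = S (2 * n) (n + 1 - k) +
      ∑ i ∈ Finset.Icc k (n - 1), S (2 * n - 2) (n - i) := by
  obtain ⟨m, rfl⟩ : ∃ m, n = m + 1 := ⟨n - 1, by omega⟩
  have key : ∀ d, d ≤ m + 1 → S (2 * m + 1) d =
      ∑ i ∈ Finset.Icc (m + 1 - d) m, S (2 * m) (m + 1 - i) := by
    intro d
    induction d with
    | zero =>
      intro _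
      rw [hS0 _ (by omega)]
      simp
    | succ d ih =>
      intro hd
      have h1 := hSodd m (d + 1) (by omega) (by omega) hd
      rw [Nat.add_sub_cancel, ih (by omega)] at h1
      rw [h1, ← Finset.add_sum_Ioc_eq_sum_Icc (a := m + 1 - (d + 1)) (b := m) (by omega)]
      have h2 : Finset.Ioc (m + 1 - (d + 1)) m = Finset.Icc (m + 1 - d) m := by
        ext x
        simp only [Finset.mem_Ioc, Finset.mem_Icc]
        omega
      have h3 : m + 1 - (m + 1 - (d + 1)) = d + 1 := by omega
      rw [h2, h3]
  have h1 := hSeven (m + 1) (m + 1 - k) (by omega) (by omega)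
  have h2 := key (m + 1 - k) (by omega)
  have e1 : 2 * (m + 1) - 1 = 2 * m + 1 := by omega
  have e2 : m + 1 - k + 1 = m + 1 + 1 - k := by omega
  have e3 : m + 1 - (m + 1 - k) = k := by omega
  have e4 : 2 * (m + 1) - 2 = 2 * m := by omega
  rw [e1, e2, h2, e3] at h1
  rw [e4, Nat.add_sub_cancel, h1, add_comm]
end

section
/- For all n ≥ 1, the total number of permutations in G^I_{2n} equals the median Genocchi number h_n; that is, |G^I_{2n}| = S(2n+2, 1). -/
namespace GIproof

/-- weight of a word -/
def W : (ℕ → ℕ → ℕ) → List ℕ → ℕ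
  | φ, [] => φ 0 0
  | φ, [a] => if Even a then φ 0 1 else φ 0 0
  | φ, a :: b :: w =>
    if a < b then
      (if Even a then
        (if Even b then W (fun p q => φ (p+1) q) (b :: w) else W (fun p q => φ p (q+1)) (b :: w))
       else 0)
    else (if Even a then W (fun p q => φ p (q+1)) (b :: w) else W φ (b :: w))

lemma W_add (w : List ℕ) : ∀ φ ψ : ℕ → ℕ → ℕ, W (fun p q => φ p q + ψ p q) w = W φ w + W ψ w := by
  induction w with
  | nil => intros; simp [W]
  | cons a w ih =>
    intro φ ψ
    cases w with
    | nil => simp only [W]; split_ifs <;> rfl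
    | cons b w =>
      simp only [W]
      split_ifs <;> simp [ih]

lemma W_zero (w : List ℕ) : W (fun _ _ => 0) w = 0 := by
  induction w with
  | nil => simp [W]
  | cons a w ih =>
    cases w with
    | nil => simp [W]
    | cons b w => simp only [W, ih]; split_ifs <;> rfl

lemma W_chain (w : List ℕ) : W (fun p _ => if p = 0 then 1 else 0) w =
    if w.IsChain (fun a b => a < b → Even a ∧ ¬ Even b) then 1 else 0 := by
  induction w with
  | nil => simp [W]
  | cons a w ih =>
    cases w with
    | nil => simp [W]
    | cons b w =>
      have h0 := W_zero (b :: w)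
      simp only [W, ih, List.isChain_cons_cons]
      by_cases h1 : a < b <;> by_cases h2 : Even a <;> by_cases h3 : Even b <;> simp [h1, h2, h3, h0]

def Eo (φ : ℕ → ℕ → ℕ) : ℕ → ℕ → ℕ := fun p q => (q+1) * φ p q + p * φ (p-1) (q+1)
def Oo (φ : ℕ → ℕ → ℕ) : ℕ → ℕ → ℕ := fun p q => (p+1) * φ p (q+1) + q * φ (p+1) q
def Eh (φ : ℕ → ℕ → ℕ) : ℕ → ℕ → ℕ := fun p q => q * φ p q + p * φ (p-1) (q+1)
def Oh (φ : ℕ → ℕ → ℕ) : ℕ → ℕ → ℕ := fun p q => p * φ p (q+1) + q * φ (p+1) q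

lemma insE_aux (M : ℕ) (hM : ¬ Even M) (w : List ℕ) : ∀ (a : ℕ) (φ : ℕ → ℕ → ℕ), a < M →
    (∀ x ∈ w, x < M) →
    ((List.permutations'Aux M w).map (fun u => W φ (a :: u))).sum = W (Eh φ) (a :: w) := by
  induction w with
  | nil =>
    intro a φ ha _
    by_cases h : Even a <;> simp [W, Eh, ha, hM, h]
  | cons b w ih =>
    intro a φ ha hw
    have hb : b < M := hw b (by simp)
    have hb' : ¬ M < b := by omega
    have ih' := fun φ => ih b φ hb (fun x hx => hw x (by simp [hx]))
    simp only [List.permutations'Aux, List.map_cons, List.map_map, List.sum_cons, Function.comp_def]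
    by_cases h1 : a < b <;> by_cases h2 : Even a <;> by_cases h3 : Even b <;>
      simp only [W, ha, hM, hb', h1, h2, h3, if_true, if_false, ih', List.map_const', List.sum_replicate, smul_zero, zero_add, ← W_add] <;>
      first
      | rfl
      | (congr 1; funext p q; simp only [Eh]; first | ring1 | (rcases p with _ | p <;> simp <;> ring1))

lemma insO_aux (M : ℕ) (hM : Even M) (w : List ℕ) : ∀ (a : ℕ) (φ : ℕ → ℕ → ℕ), a < M →
    (∀ x ∈ w, x < M) →
    ((List.permutations'Aux M w).map (fun u => W φ (a :: u))).sum = W (Oh φ) (a :: w) := by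
  induction w with
  | nil =>
    intro a φ ha _
    by_cases h : Even a <;> simp [W, Oh, ha, hM, h]
  | cons b w ih =>
    intro a φ ha hw
    have hb : b < M := hw b (by simp)
    have hb' : ¬ M < b := by omega
    have ih' := fun φ => ih b φ hb (fun x hx => hw x (by simp [hx]))
    simp only [List.permutations'Aux, List.map_cons, List.map_map, List.sum_cons, Function.comp_def]
    by_cases h1 : a < b <;> by_cases h2 : Even a <;> by_cases h3 : Even b <;>
      simp only [W, ha, hM, hb', h1, h2, h3, if_true, if_false, ih', List.map_const', List.sum_replicate, smul_zero, zero_add, ← W_add] <;>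
      first
      | rfl
      | (congr 1; funext p q; simp only [Oh]; first | ring1 | (rcases p with _ | p <;> simp <;> ring1))

lemma insE (M : ℕ) (hM : ¬ Even M) (w : List ℕ) (φ : ℕ → ℕ → ℕ) (hw : ∀ x ∈ w, x < M) :
    ((List.permutations'Aux M w).map (W φ)).sum = W (Eo φ) w := by
  cases w with
  | nil => simp [W, Eo, hM]
  | cons a w =>
    have ha : a < M := hw a (by simp)
    have ha' : ¬ M < a := by omega
    have := insE_aux M hM w a φ ha (fun x hx => hw x (by simp [hx]))
    simp only [List.permutations'Aux, List.map_cons, List.map_map, List.sum_cons, Function.comp_def, this]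
    simp only [W, ha', hM, if_false, ← W_add]
    congr 1; funext p q; simp only [Eh, Eo]; ring

lemma insO (M : ℕ) (hM : Even M) (w : List ℕ) (φ : ℕ → ℕ → ℕ) (hw : ∀ x ∈ w, x < M) :
    ((List.permutations'Aux M w).map (W φ)).sum = W (Oo φ) w := by
  cases w with
  | nil => simp [W, Oo, hM]
  | cons a w =>
    have ha : a < M := hw a (by simp)
    have ha' : ¬ M < a := by omega
    have := insO_aux M hM w a φ ha (fun x hx => hw x (by simp [hx]))
    simp only [List.permutations'Aux, List.map_cons, List.map_map, List.sum_cons, Function.comp_def, this]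
    simp only [W, ha', hM, if_true, if_false, ← W_add]
    congr 1; funext p q; simp only [Oh, Oo]; ring

def desc : ℕ → List ℕ
  | 0 => []
  | m+1 => m :: desc m

lemma mem_desc (m x : ℕ) : x ∈ desc m ↔ x < m := by
  induction m with
  | zero => simp [desc]
  | succ m ih => simp [desc, ih]; omega

lemma nodup_desc (m : ℕ) : (desc m).Nodup := by
  induction m with
  | zero => simp [desc]
  | succ m ih => simp [desc, ih, mem_desc]

lemma length_desc (m : ℕ) : (desc m).length = m := by
  induction m with
  | zero => simp [desc]
  | succ m ih => simp [desc, ih]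

def tot (m : ℕ) (φ : ℕ → ℕ → ℕ) : ℕ := ((desc m).permutations'.map (W φ)).sum

lemma tot_succ (m : ℕ) (φ ψ : ℕ → ℕ → ℕ)
    (h : ∀ w : List ℕ, (∀ x ∈ w, x < m) → ((List.permutations'Aux m w).map (W φ)).sum = W ψ w) :
    tot (m+1) φ = tot m ψ := by
  unfold tot
  simp only [desc, List.permutations', List.map_flatMap]
  rw [List.flatMap, List.sum_flatten, List.map_map]
  congr 1
  apply List.map_congr_left
  intro w hw
  apply h
  intro x hx
  rw [List.mem_permutations'] at hw
  exact (mem_desc m x).1 (hw.subset hx)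

def Cc : ℕ → ℕ → ℕ → ℕ
  | 0 => fun p _ => if p = 0 then 1 else 0
  | r+1 => Oo (Eo (Cc r))

lemma tot_Cc (j : ℕ) : ∀ r, tot (2*j) (Cc r) = Cc (r + j) 0 0 := by
  induction j with
  | zero => intro r; simp [tot, desc, W]
  | succ j ih =>
    intro r
    have h1 : tot (2*j+1+1) (Cc r) = tot (2*j+1) (Eo (Cc r)) :=
      tot_succ _ _ _ (fun w hw => insE _ (by simp) w _ hw)
    have h2 : tot (2*j+1) (Eo (Cc r)) = tot (2*j) (Oo (Eo (Cc r))) :=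
      tot_succ _ _ _ (fun w hw => insO _ (by simp) w _ hw)
    have h3 := ih (r+1)
    rw [show 2*(j+1) = 2*j+1+1 by ring, h1, h2, show r + (j+1) = r+1+j by ring, ← h3]
    rfl

end GIproof
namespace GIproof
section
open Polynomial

/-- f(y)+f(y-1) -/
noncomputable def T : ℚ[X] →ₗ[ℚ] ℚ[X] :=
  LinearMap.id + (Polynomial.aeval (X - 1 : ℚ[X])).toLinearMap

lemma T_apply (f : ℚ[X]) : T f = f + f.comp (X - 1) := by
  simp [T, Polynomial.comp, Polynomial.aeval_def, Polynomial.algebraMap_eq]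

lemma T_natDegree (f : ℚ[X]) : (T f).natDegree ≤ f.natDegree ∧ (T f).coeff f.natDegree = 2 * f.leadingCoeff := by
  have h1 : (X - 1 : ℚ[X]).natDegree = 1 := by
    rw [← C_1]; exact natDegree_X_sub_C 1
  have h1' : (X - 1 : ℚ[X]).leadingCoeff = 1 := by
    rw [← C_1]; exact leadingCoeff_X_sub_C 1
  have h2 : (f.comp (X - 1)).natDegree = f.natDegree := by rw [natDegree_comp, h1, mul_one]
  have h3 : (f.comp (X - 1)).leadingCoeff = f.leadingCoeff := by
    rw [leadingCoeff_comp (by rw [h1]; norm_num), h1']; simp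
  rw [T_apply]
  refine ⟨(natDegree_add_le _ _).trans (by rw [h2]; simp), ?_⟩
  have h4 : (f.comp (X - 1)).coeff f.natDegree = f.leadingCoeff := by
    rw [← h3, leadingCoeff, h2]
  rw [coeff_add, h4]
  change f.leadingCoeff + _ = _
  ring

lemma T_inj : Function.Injective T := by
  rw [injective_iff_map_eq_zero]
  intro f hf
  have := (T_natDegree f).2
  rw [hf] at this
  simpa using this.symm

lemma T_surj : Function.Surjective T := by
  rw [← LinearMap.range_eq_top, eq_top_iff]
  have key : ∀ n, ∀ f : ℚ[X], f.natDegree < n → f ∈ LinearMap.range T := by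
    intro n
    induction n with
    | zero => intro f hf; omega
    | succ n ih =>
      intro f hf
      have h2 : T (C (f.leadingCoeff/2) * X ^ f.natDegree) + (f - T (C (f.leadingCoeff/2) * X ^ f.natDegree)) = f := by ring
      rw [← h2]
      by_cases hf0 : f = 0
      · subst hf0; simp
      refine Submodule.add_mem _ (LinearMap.mem_range_self _ _) ?_
      have hc : f.leadingCoeff / 2 ≠ 0 := by simpa using hf0
      have hd : (C (f.leadingCoeff/2) * X ^ f.natDegree).natDegree = f.natDegree := natDegree_C_mul_X_pow _ _ hc
      have hT := T_natDegree (C (f.leadingCoeff/2) * X ^ f.natDegree)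
      rw [hd] at hT
      by_cases hz : f - T (C (f.leadingCoeff/2) * X ^ f.natDegree) = 0
      · rw [hz]; exact Submodule.zero_mem _
      by_cases hz0 : f.natDegree = 0
      · exfalso; apply hz
        have hle : (f - T (C (f.leadingCoeff/2) * X ^ f.natDegree)).natDegree ≤ 0 :=
          (natDegree_sub_le _ _).trans (by rw [hz0] at hT ⊢; simpa using hT.1)
        rw [eq_C_of_natDegree_le_zero hle, coeff_sub]
        have := hT.2
        rw [leadingCoeff_C_mul_X_pow, mul_div_cancel₀ _ (two_ne_zero' ℚ), leadingCoeff] at this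
        rw [hz0] at this ⊢
        rw [leadingCoeff, hz0, this]; simp
      · apply ih
        have hle : (f - T (C (f.leadingCoeff/2) * X ^ f.natDegree)).natDegree ≤ f.natDegree :=
          (natDegree_sub_le _ _).trans (by simpa using hT.1)
        rcases lt_or_eq_of_le hle with h | h
        · omega
        · exfalso
          have : (f - T (C (f.leadingCoeff/2) * X ^ f.natDegree)).leadingCoeff = 0 := by
            rw [leadingCoeff, h, coeff_sub, hT.2, leadingCoeff_C_mul_X_pow, mul_div_cancel₀ _ (two_ne_zero' ℚ), leadingCoeff, sub_self]
          exact hz (leadingCoeff_eq_zero.1 this)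
  intro f _
  exact key _ f (Nat.lt_succ_self _)

noncomputable def Te : ℚ[X] ≃ₗ[ℚ] ℚ[X] := LinearEquiv.ofBijective T ⟨T_inj, T_surj⟩

noncomputable def L (f : ℚ[X]) : ℚ := 2 * (derivative (Te.symm f)).eval 0

lemma L_add (f g) : L (f + g) = L f + L g := by simp [L]; ring
lemma L_sub (f g) : L (f - g) = L f - L g := by simp [L]; ring
lemma L_smul (c : ℚ) (f) : L (C c * f) = c * L f := by
  rw [← smul_eq_C_mul]; simp [L]; ring

lemma L_T (f) : L (f + f.comp (X - 1)) = 2 * (derivative f).eval 0 := by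
  rw [← T_apply]
  have : Te.symm (T f) = f := by
    rw [LinearEquiv.symm_apply_eq]; rfl
  rw [L, this]

lemma ex_T (f : ℚ[X]) : ∃ g : ℚ[X], f = g + g.comp (X - 1) := by
  obtain ⟨g, hg⟩ := T_surj f
  exact ⟨g, by rw [← hg, T_apply]⟩

lemma L_refl (f : ℚ[X]) : L (f.comp (1 - X)) = - L f := by
  obtain ⟨g, rfl⟩ := ex_T f
  have h : (g + g.comp (X - 1)).comp (1 - X) = g.comp (-X) + (g.comp (-X)).comp (X - 1) := by
    rw [add_comp, comp_assoc, comp_assoc, add_comm]; simp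
  rw [h, L_T, L_T]
  simp [derivative_comp]

lemma L_neg (f : ℚ[X]) : L (f.comp (-X)) = L f - 2 * (derivative f).eval 0 := by
  obtain ⟨g, rfl⟩ := ex_T f
  have h : (g + g.comp (X - 1)).comp (-X) = g.comp (-X - 1) + (g.comp (-X - 1)).comp (X - 1) := by
    rw [add_comp, comp_assoc, comp_assoc, add_comm]; simp
  rw [h, L_T, L_T]
  simp [derivative_comp]; ring

lemma L_odd (m : ℕ) : L (X ^ (2*m+1)) = if m = 0 then 1 else 0 := by
  have h := L_neg (X ^ (2*m+1))
  have h2 : (X ^ (2*m+1) : ℚ[X]).comp (-X) = C (-1) * X ^ (2*m+1) := by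
    simp [Odd.neg_pow (⟨m, rfl⟩ : Odd (2*m+1))]
  rw [h2, L_smul] at h
  rcases m with _ | m
  · simp at h ⊢; linarith
  · simp [derivative_X_pow] at h ⊢; linarith

lemma L_sym (m : ℕ) : L ((1 - X)^m * X ^ m) = 0 := by
  have h := L_refl ((1 - X)^m * X ^ m)
  have h2 : ((1 - X : ℚ[X])^m * X ^ m).comp (1 - X) = (1 - X)^m * X ^ m := by
    simp; ring
  rw [h2] at h; linarith

lemma L_X2 : L (X^2) = 1 := by
  have h := L_sym 1
  have h1 := L_odd 0
  have : (X : ℚ[X])^2 = X^(2*0+1) - (1-X)^1*X^1 := by ring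
  rw [this, L_sub, h, h1]; simp

/-- p_k -/
noncomputable def P (k : ℕ) : ℚ[X] := ∏ i ∈ Finset.range (k+1), ((C (i:ℚ) + X) * (C ((i:ℚ)+1) - X))
/-- f_k, with f_k' (0) = (k+1)!^2 -/
noncomputable def Fp (k : ℕ) : ℚ[X] := ∏ i ∈ Finset.range (k+1), ((C ((i:ℚ)+1) + X) * (C ((i:ℚ)+1) - X))

lemma P_succ (k : ℕ) : P (k+1) = P k * ((1-X)*X) + C (((k:ℚ)+1)*(k+2)) * P k := by
  rw [P, Finset.prod_range_succ, ← P]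
  simp only [map_add, map_mul, Nat.cast_add, Nat.cast_one, C_1, map_ofNat]
  ring

lemma Fp_succ (k : ℕ) : Fp (k+1) = Fp k * ((C ((k:ℚ)+2) + X) * (C ((k:ℚ)+2) - X)) := by
  rw [Fp, Finset.prod_range_succ, ← Fp]
  simp only [map_add, map_mul, Nat.cast_add, Nat.cast_one, C_1, map_ofNat]
  ring

lemma P_refl (k : ℕ) : (P k).comp (1 - X) = P k := by
  induction k with
  | zero => simp [P]; ring
  | succ k ih => simp only [P_succ, add_comp, mul_comp, ih, C_comp, sub_comp, X_comp, one_comp]; ring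

lemma L_P (k : ℕ) : L (P k) = 0 := by
  have h := L_refl (P k)
  rw [P_refl] at h; linarith

/-- X * Fp k = P k * (X+k+1) -/
lemma F1 (k : ℕ) : X * Fp k = P k * (X + C ((k:ℚ)+1)) := by
  induction k with
  | zero => simp [Fp, P]; ring
  | succ k ih =>
    rw [Fp_succ, ← mul_assoc, ih, P_succ]
    simp only [map_add, map_mul, Nat.cast_add, Nat.cast_one, C_1, map_ofNat]; ring

lemma F2 (k : ℕ) : (X * Fp k).comp (X - 1) = P k * (X - C ((k:ℚ)+2)) := by
  induction k with
  | zero => simp [Fp, P, map_ofNat]; ring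
  | succ k ih =>
    rw [Fp_succ, ← mul_assoc, mul_comp, ih, P_succ]
    simp only [map_add, map_mul, Nat.cast_add, Nat.cast_one, C_1, map_ofNat, add_comp, sub_comp, mul_comp, X_comp, C_comp, natCast_comp, ofNat_comp, one_comp]; ring

lemma Fp_eval (k : ℕ) : (Fp k).eval 0 = ((k+1).factorial : ℚ)^2 := by
  induction k with
  | zero => simp [Fp]
  | succ k ih => rw [Fp_succ, eval_mul, ih, Nat.factorial_succ (k+1)]; simp; ring

lemma L_XP (k : ℕ) : L (X * P k) = ((k+1).factorial : ℚ)^2 := by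
  have h := L_T (X * Fp k)
  rw [F2, F1] at h
  have h2 : P k * (X + C ((k:ℚ)+1)) + P k * (X - C ((k:ℚ)+2)) = C 2 * (X * P k) - P k := by
    simp only [map_add, C_1, map_ofNat]; ring
  rw [h2, L_sub, L_P, L_smul, ← F1] at h
  simp [Fp_eval] at h
  linarith

noncomputable def Q' (n k : ℕ) : ℚ := L (X * P k * ((1-X)*X)^n) / ((k+1).factorial : ℚ)^2

lemma Q'_zero (k : ℕ) : Q' 0 k = 1 := by
  have : ((k+1).factorial : ℚ) ≠ 0 := by positivity
  simp [Q', L_XP, this]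

lemma Q'_succ (n k : ℕ) : Q' (n+1) k = (k+2)*((k+2) * Q' n (k+1) - (k+1) * Q' n k) := by
  have h0 : ((k+1).factorial : ℚ) ≠ 0 := by positivity
  have h1 : X * P k * ((1-X)*X)^(n+1) = X * P (k+1) * ((1-X)*X)^n - C (((k:ℚ)+1)*(k+2)) * (X * P k * ((1-X)*X)^n) := by
    rw [P_succ]; ring
  simp only [Q']
  rw [h1, L_sub, L_smul, Nat.factorial_succ (k+1)]
  push_cast
  have : (k:ℚ)+1+1 ≠ 0 := by positivity
  field_simp
  ring

/-- Seidel array -/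
lemma seidel (S : ℕ → ℕ → ℕ)
    (hS1 : S 1 1 = 1)
    (hS0 : ∀ r, 1 ≤ r → S r 0 = 0)
    (hStop : ∀ r k, 1 ≤ r → r + 1 < 2 * k → S r k = 0)
    (hSeven : ∀ m k, 1 ≤ m → 1 ≤ k →
      S (2 * m) k = S (2 * m - 1) k + S (2 * m) (k + 1))
    (hSodd : ∀ m k, 1 ≤ m → 1 ≤ k → k ≤ m + 1 →
      S (2 * m + 1) k = S (2 * m) k + S (2 * m + 1) (k - 1)) (m : ℕ) :
    (∀ j k, k + j = m + 1 → 1 ≤ k → (S (2*m+1) k : ℚ) = (-1)^(k+1) * L ((1-X)^j * X^(m+1+k))) ∧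
    (∀ j k, k + j = m + 2 → 1 ≤ k → (S (2*m+2) k : ℚ) = (-1)^(k+1) * L ((1-X)^j * X^(m+1+k))) := by
  have even_step : ∀ m : ℕ, (∀ j k, k + j = m + 1 → 1 ≤ k → (S (2*m+1) k : ℚ) = (-1)^(k+1) * L ((1-X)^j * X^(m+1+k))) →
    (∀ j k, k + j = m + 2 → 1 ≤ k → (S (2*m+2) k : ℚ) = (-1)^(k+1) * L ((1-X)^j * X^(m+1+k))) := by
    intro m h j
    induction j with
    | zero =>
      intro k hk _
      obtain rfl : k = m + 2 := by omega
      rw [hStop _ _ (by omega) (by omega)]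
      have := L_odd (m+1)
      rw [show m + 1 + (m+2) = 2*(m+1)+1 by ring]
      simp [this]
    | succ j ih =>
      intro k hk hk1
      have h1 := hSeven (m+1) k (by omega) hk1
      rw [show 2*(m+1) - 1 = 2*m+1 by omega, show 2*(m+1) = 2*m+2 by ring] at h1
      rw [h1]; push_cast
      rw [h j k (by omega) hk1, ih (k+1) (by omega) (by omega)]
      have : ((1-X)^(j+1) * X^(m+1+k) : ℚ[X]) = (1-X)^j * X^(m+1+k) - (1-X)^j*X^(m+1+(k+1)) := by ring
      rw [this, L_sub]; ring
  have odd_step : ∀ m : ℕ, 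
    (∀ j k, k + j = m + 2 → 1 ≤ k → (S (2*m+2) k : ℚ) = (-1)^(k+1) * L ((1-X)^j * X^(m+1+k))) →
    (∀ k j, k + j = m + 1 + 1 → (S (2*(m+1)+1) k : ℚ) = (-1)^(k+1) * L ((1-X)^j * X^(m+1+1+k))) := by
    intro m h k
    induction k with
    | zero =>
      intro j hj
      obtain rfl : j = m + 2 := by omega
      rw [hS0 _ (by omega)]
      rw [show m+1+1+0 = m+2 by ring, L_sym]; simp
    | succ k ih =>
      intro j hj
      have h1 := hSodd (m+1) (k+1) (by omega) (by omega) (by omega)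
      rw [h1]; push_cast
      rw [show 2*(m+1) = 2*m+2 by ring, h j (k+1) (by omega) (by omega)]
      rw [show 2*m+2+1 = 2*(m+1)+1 by ring, ih (j+1) (by omega)]
      have : ((1-X)^(j+1) * X^(m+1+1+k) : ℚ[X]) = (1-X)^j * X^(m+1+(k+1)) - (1-X)^j*X^(m+1+1+(k+1)) := by ring
      rw [this, L_sub]; ring
  induction m with
  | zero =>
    have h : (∀ j k, k + j = 0 + 1 → 1 ≤ k → (S (2*0+1) k : ℚ) = (-1)^(k+1) * L ((1-X)^j * X^(0+1+k))) := by
      intro j k hk hk1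
      obtain rfl : k = 1 := by omega
      obtain rfl : j = 0 := by omega
      simp [hS1, L_X2]
    exact ⟨h, even_step 0 h⟩
  | succ m ih =>
    have h := odd_step m ih.2
    have h' := fun j k hk (_ : 1 ≤ k) => h k j hk
    exact ⟨h', even_step (m+1) h'⟩

end
end GIproof

namespace GIproof

lemma Eo_delta (φ : ℕ → ℕ → ℕ) (h : ∀ p q, φ p (q+1) = φ p q + φ (p+1) q) (p q : ℕ) :
    Eo φ p (q+1) = Eo φ p q + Eo φ (p+1) q := by
  simp only [Eo]
  rcases p with _ | p
  · simp; rw [h 0 q]; ring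
  · simp only [Nat.add_sub_cancel]; rw [h p (q+1), h (p+1) q]; ring

lemma Oo_delta (φ : ℕ → ℕ → ℕ) (h : ∀ p q, φ p (q+1) = φ p q + φ (p+1) q) (p q : ℕ) :
    Oo φ p (q+1) = Oo φ p q + Oo φ (p+1) q := by
  simp only [Oo]
  rw [h p (q+1), h (p+1) q]; ring

lemma Cc_delta (r : ℕ) : ∀ p q, Cc r p (q+1) = Cc r p q + Cc r (p+1) q := by
  induction r with
  | zero => intro p q; simp [Cc]
  | succ r ih => exact Oo_delta _ (Eo_delta _ ih)

lemma Cc_rec (r q : ℕ) : (Cc (r+1) 0 q : ℚ) =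
    (q+1) * ((q+2) * Cc r 0 (q+1) - q * Cc r 0 q) := by
  have h := Eo_delta _ (Cc_delta r) 0 q
  have h1 : Eo (Cc r) 0 (q+1) = (q+2) * Cc r 0 (q+1) := by simp [Eo]
  have h2 : Eo (Cc r) 0 q = (q+1) * Cc r 0 q := by simp [Eo]
  have h3 : Cc (r+1) 0 q = Eo (Cc r) 0 (q+1) + q * Eo (Cc r) 1 q := by simp [Cc, Oo]
  have h4 : (Eo (Cc r) 1 q : ℚ) = Eo (Cc r) 0 (q+1) - Eo (Cc r) 0 q := by
    rw [h]; push_cast; ring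
  rw [h3]; push_cast
  rw [h4, h1, h2]; push_cast; ring

lemma Cc_eq (n : ℕ) : (Cc n 0 0 : ℚ) = Q' n 0 ∧
    ∀ k : ℕ, (Cc n 0 (k+1) : ℚ) = (k+2) * Q' n (k+1) - (k+1) * Q' n k := by
  induction n with
  | zero => simp [Cc, Q'_zero]; norm_num
  | succ n ih =>
    obtain ⟨_, ih⟩ := ih
    refine ⟨?_, fun k => ?_⟩
    · rw [Cc_rec, Q'_succ, ih]; simp
    · rw [Cc_rec, Q'_succ, Q'_succ, ih, ih]; push_cast; ring

lemma Cc_seidel (n : ℕ) : (Cc n 0 0 : ℚ) = L ((1-Polynomial.X)^(n+1) * Polynomial.X^(n+1+1)) := by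
  rw [(Cc_eq n).1, Q']
  have h : (Polynomial.X * P 0 * ((1-Polynomial.X)*Polynomial.X)^n : Polynomial ℚ)
    = (1-Polynomial.X)^(n+1) * Polynomial.X^(n+1+1) := by rw [mul_pow]; simp [P]; ring
  rw [h]; simp

lemma card_eq (m : ℕ) : Nat.card {π : Equiv.Perm (Fin m) // IsGI π} = tot m (Cc 0) := by
  classical
  set R : ℕ → ℕ → Prop := fun a b => a < b → Even a ∧ ¬ Even b with hR
  have h1 : tot m (Cc 0) = ((desc m).permutations'.toFinset.filter (fun w => w.IsChain R)).card := by
    have hnd : (desc m).permutations'.Nodup := (List.permutations_perm_permutations' _).nodup_iff.1 (List.nodup_permutations _ (nodup_desc m))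
    rw [Finset.card_filter, List.sum_toFinset _ hnd]
    unfold tot
    congr 1
    apply List.map_congr_left
    intro w _
    exact W_chain w
  have hch : ∀ π : Equiv.Perm (Fin m), (List.ofFn (fun i => (π i : ℕ))).IsChain R ↔ IsGI π := by
    intro π
    rw [List.isChain_iff_getElem]
    simp only [List.length_ofFn, List.getElem_ofFn, hR, IsGI]
    constructor
    · intro h i j hij hlt
      have := h i (by omega)
      have hj : (⟨(i:ℕ)+1, by omega⟩ : Fin m) = j := Fin.ext hij
      simp only [hj, Fin.eta] at this
      have := this hlt
      rw [Nat.odd_add_one, Nat.even_add_one, Nat.not_odd_iff_even]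
      simpa using this
    · intro h i hi hlt
      have := h ⟨i, by omega⟩ ⟨i+1, by omega⟩ rfl hlt
      rw [Nat.odd_add_one, Nat.even_add_one, Nat.not_odd_iff_even] at this
      simpa using this
  have hmem : ∀ w : List ℕ, w ∈ (desc m).permutations'.toFinset.filter (fun w => w.IsChain R) ↔
      w.Perm (desc m) ∧ w.IsChain R := by
    intro w; simp
  rw [h1, ← Nat.card_eq_finsetCard]
  refine Nat.card_congr (Equiv.ofBijective
    (fun π => ⟨List.ofFn (fun i => (π.1 i : ℕ)), ?_⟩) ⟨?_, ?_⟩)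
  · rw [hmem]
    refine ⟨?_, (hch π.1).2 π.2⟩
    rw [List.perm_ext_iff_of_nodup _ (nodup_desc m)]
    · intro x
      rw [mem_desc, List.mem_ofFn]
      constructor
      · rintro ⟨i, rfl⟩; exact (π.1 i).2
      · intro hx
        exact ⟨π.1.symm ⟨x, hx⟩, by simp⟩
    · rw [List.nodup_ofFn]
      intro i j hij
      exact π.1.injective (Fin.ext hij)
  · intro π σ h
    simp only [Subtype.mk.injEq, List.ofFn_inj] at h
    apply Subtype.ext
    apply Equiv.ext
    intro i
    exact Fin.ext (congrFun h i)
  · rintro ⟨w, hw⟩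
    have hw' := (hmem w).1 hw
    have hlen : w.length = m := by rw [hw'.1.length_eq, length_desc]
    have hnd : w.Nodup := hw'.1.nodup_iff.2 (nodup_desc m)
    have hlt : ∀ i : Fin m, w[(i:ℕ)]'(by omega) < m := fun i =>
      (mem_desc m _).1 (hw'.1.subset (List.getElem_mem _))
    let f : Fin m → Fin m := fun i => ⟨w[(i:ℕ)]'(by omega), hlt i⟩
    have hf : Function.Injective f := by
      intro i j hij
      have := congrArg Fin.val hij
      simp only [f] at this
      exact Fin.ext ((hnd.getElem_inj_iff).1 this)
    let π : Equiv.Perm (Fin m) := Equiv.ofBijective f (Finite.injective_iff_bijective.1 hf)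
    have hofn : List.ofFn (fun i => (π i : ℕ)) = w := by
      apply List.ext_getElem
      · simp [hlen]
      · intro i h1 h2
        simp [π, f]
    refine ⟨⟨π, (hch π).1 (by rw [hofn]; exact hw'.2)⟩, ?_⟩
    exact Subtype.ext hofn

end GIproof
/-- For all `n ≥ 1`, `|G^I_{2n}| = h_n = S(2n+2, 1)`, the median Genocchi number. -/
theorem card_GI_eq_median_genocchi
    (S : ℕ → ℕ → ℕ)
    (hS1 : S 1 1 = 1)
    (hS0 : ∀ r, 1 ≤ r → S r 0 = 0)
    (hStop : ∀ r k, 1 ≤ r → r + 1 < 2 * k → S r k = 0)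
    (hSeven : ∀ m k, 1 ≤ m → 1 ≤ k →
      S (2 * m) k = S (2 * m - 1) k + S (2 * m) (k + 1))
    (hSodd : ∀ m k, 1 ≤ m → 1 ≤ k → k ≤ m + 1 →
      S (2 * m + 1) k = S (2 * m) k + S (2 * m + 1) (k - 1))
    (n : ℕ) (hn : 1 ≤ n) :
    Nat.card {π : Equiv.Perm (Fin (2 * n)) // IsGI π} = S (2 * n + 2) 1 := by
  have h := ((GIproof.seidel S hS1 hS0 hStop hSeven hSodd n).2 (n+1) 1 (by omega) le_rfl)
  rw [GIproof.card_eq, GIproof.tot_Cc, zero_add]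
  have h2 := GIproof.Cc_seidel n
  rw [← h2] at h
  have h3 : (S (2*n+2) 1 : ℚ) = (GIproof.Cc n 0 0 : ℚ) := by rw [h]; ring
  exact_mod_cast h3.symm
end

section
/- For all n ≥ 2 and all 0 ≤ k < n, |D^III_{2n,2k+2}| = |D^III_{2n,2k}| + Σ_{i=k}^{n−1} |D^III_{2n−2,2i}|, where by convention |D^III_{2m,0}| = 0 for every m. -/
/-- A Dumont permutation of the third kind of `{1, …, m}`: every descent
`σ_i > σ_{i+1}` has both `σ_i` and `σ_{i+1}` even. -/
def IsDIII {m : ℕ} (σ : Equiv.Perm (Fin m)) : Prop :=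
  ∀ i j : Fin m, (i : ℕ) + 1 = (j : ℕ) → σ j < σ i →
    Even ((σ i : ℕ) + 1) ∧ Even ((σ j : ℕ) + 1)

/-- The leftmost even entry of the one-line notation of `σ` is `v`:
`v` occurs at some position all of whose earlier entries are odd. -/
def LeftmostEvenIs {m : ℕ} (σ : Equiv.Perm (Fin m)) (v : ℕ) : Prop :=
  ∃ i : Fin m, (σ i : ℕ) + 1 = v ∧ ∀ j : Fin m, j < i → Odd ((σ j : ℕ) + 1)

set_option linter.unusedSimpArgs false
namespace DIII

def Hd (x : ℕ) : List ℕ → Prop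
  | [] => x ≠ 0
  | y :: _ => (x = 0 → y ≠ 0 ∧ Even y) ∧ (y ≠ 0 → y < x → Even x ∧ Even y)

def Ok : List ℕ → Prop
  | [] => True
  | x :: t => Hd x t ∧ Ok t

def ins (v : ℕ) : List ℕ → List (List ℕ)
  | [] => if Even v then [[v], [0, v]] else [[v]]
  | x :: t =>
    (if x = 0 then
      (if Even v then [v :: t, v :: 0 :: t, 0 :: v :: t, 0 :: v :: 0 :: t] else [v :: 0 :: t])
     else []) ++ (ins v t).map (fun c => x :: c)

def st : List ℕ → ℕ
  | [] => 0
  | x :: t => if Even x then x else st t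

def Eo (f : ℕ → ℕ) (p : ℕ) : ℕ := p * f (p - 1) + (2 * p + 1) * f p + (p + 1) * f (p + 1)
def Fo (f : ℕ → ℕ) (p : ℕ) : ℕ := f p + if p = 0 then 0 else f (p - 1)
def Ro (f : ℕ → ℕ) (p : ℕ) : ℕ := (p - 1) * f (p - 1) + 2 * p * f p + (p + 1) * f (p + 1)
def Oo (f : ℕ → ℕ) (p : ℕ) : ℕ := (p + 1) * f p

theorem sumE {v : ℕ} (hv : v ≠ 0) (he : Even v) (w : List ℕ) : ∀ f : ℕ → ℕ,
    ((ins v w).map (fun c => f (c.count 0))).sum = Eo f (w.count 0) := by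
  induction w with
  | nil => intro f; simp [ins, he, Eo, List.count_cons, hv]
  | cons x t ih =>
    intro f
    by_cases hx : x = 0
    · subst hx
      have := ih (fun q => f (q + 1))
      simp only [ins, he, if_true, List.map_append, List.map_map, List.sum_append]
      have e : ((fun c : List ℕ => f (c.count 0)) ∘ fun c => 0 :: c) =
        fun c => f (c.count 0 + 1) := by ext c; simp
      rw [e, this]
      rcases h : t.count 0 with _ | p <;> simp [Eo, List.count_cons, hv, h] <;> ring
    · have e : ((fun c : List ℕ => f (c.count 0)) ∘ fun c => x :: c) =
        fun c => f (c.count 0) := by ext c; simp [List.count_cons, hx]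
      simp [ins, hx, List.map_map, e, ih, List.count_cons]

theorem sumO {v : ℕ} (hv : v ≠ 0) (he : ¬ Even v) (w : List ℕ) : ∀ f : ℕ → ℕ,
    ((ins v w).map (fun c => f (c.count 0))).sum = Oo f (w.count 0) := by
  induction w with
  | nil => intro f; simp [ins, he, Oo, List.count_cons, hv]
  | cons x t ih =>
    intro f
    by_cases hx : x = 0
    · subst hx
      have := ih (fun q => f (q + 1))
      have e : ((fun c : List ℕ => f (c.count 0)) ∘ fun c => 0 :: c) =
        fun c => f (c.count 0 + 1) := by ext c; simp
      simp only [ins, he, if_true, List.map_append, List.map_map, List.sum_append]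
      rw [e, this]
      simp [Oo, List.count_cons, hv]; ring
    · have e : ((fun c : List ℕ => f (c.count 0)) ∘ fun c => x :: c) =
        fun c => f (c.count 0) := by ext c; simp [List.count_cons, hx]
      simp [ins, hx, List.map_map, e, ih, List.count_cons]

def tst (s : ℕ) (f : ℕ → ℕ) (c : List ℕ) : ℕ := if st c = s then f (c.count 0) else 0

theorem tst_odd {x : ℕ} (hx : ¬ Even x) (s : ℕ) (f : ℕ → ℕ) (c : List ℕ) :
    tst s f (x :: c) = tst s f c := by
  have : x ≠ 0 := by rintro rfl; simp at hx
  simp [tst, st, hx, List.count_cons, this]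

theorem tst_even {x : ℕ} (h0 : x ≠ 0) (hx : Even x) (s : ℕ) (f : ℕ → ℕ) (c : List ℕ) :
    tst s f (x :: c) = if x = s then f (c.count 0) else 0 := by
  simp [tst, st, hx, List.count_cons, h0]

theorem tst_zero (s : ℕ) (f : ℕ → ℕ) (c : List ℕ) :
    tst s f (0 :: c) = if 0 = s then f (c.count 0 + 1) else 0 := by
  simp [tst, st]

theorem sum_odd {v : ℕ} (hv : v ≠ 0) (he : ¬ Even v) (s : ℕ) (f : ℕ → ℕ) (w : List ℕ) :
    ((ins v w).map (tst s f)).sum = tst s (Oo f) w := by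
  induction w with
  | nil => 
    by_cases h : 0 = s
    · subst h; simp [ins, he, tst, Oo, st, hv]
    · simp [ins, he, tst_odd, tst, Oo, st, h]
  | cons x t ih =>
    by_cases hx : x = 0
    · subst hx
      have := sumO hv he t (fun q => f (q + 1))
      simp only [ins, he, List.map_append, List.map_map, List.sum_append, Function.comp_def,
        tst_zero]
      by_cases hs : 0 = s
      · subst hs
        simp only [if_true, this]
        simp [tst_odd he, tst_zero, Oo]; ring
      · simp [tst_odd he, tst_zero, hs]
    · by_cases hx2 : Even x
      · simp [ins, hx, Function.comp_def, tst_even hx hx2]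
        split_ifs
        · exact sumO hv he t f
        · simp
      · simp [ins, hx, Function.comp_def, tst_odd hx2, ih]

theorem sum_even_other {v : ℕ} (hv : v ≠ 0) (he : Even v) (s : ℕ) (h0 : s ≠ 0) (hs : s ≠ v)
    (f : ℕ → ℕ) (w : List ℕ) :
    ((ins v w).map (tst s f)).sum = tst s (Eo f) w := by
  induction w with
  | nil => simp [ins, he, tst_even hv he, tst_zero, h0.symm, hs.symm]; simp [tst, st, h0.symm]
  | cons x t ih =>
    by_cases hx : x = 0
    · subst hx
      simp [ins, he, Function.comp_def, tst_even hv he, tst_zero, h0.symm, hs.symm]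
    · by_cases hx2 : Even x
      · simp [ins, hx, Function.comp_def, tst_even hx hx2]
        split_ifs
        · exact sumE hv he t f
        · simp
      · simp [ins, hx, Function.comp_def, tst_odd hx2, ih]

theorem sum_even_self {v : ℕ} (hv : v ≠ 0) (he : Even v)
    (f : ℕ → ℕ) (w : List ℕ) (hw : v ∉ w) :
    ((ins v w).map (tst v f)).sum = tst 0 (Fo f) w := by
  induction w with
  | nil => simp [ins, he, tst_even hv he, tst_zero, hv.symm]; simp [tst, st, Fo]
  | cons x t ih =>
    by_cases hx : x = 0
    · subst hx
      simp [ins, he, Function.comp_def, tst_even hv he, tst_zero, hv.symm, Fo]; ring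
    · by_cases hx2 : Even x
      · simp only [List.mem_cons, not_or] at hw
        simp [ins, hx, Function.comp_def, tst_even hx hx2, Ne.symm hw.1]
      · simp only [List.mem_cons, not_or] at hw
        simp [ins, hx, Function.comp_def, tst_odd hx2, ih hw.2]

theorem sum_even_zero {v : ℕ} (hv : v ≠ 0) (he : Even v)
    (f : ℕ → ℕ) (w : List ℕ) :
    ((ins v w).map (tst 0 f)).sum = tst 0 (Ro f) w := by
  induction w with
  | nil => simp [ins, he, tst_even hv he, tst_zero, hv]; simp [tst, st, Ro, List.count_cons, hv]
  | cons x t ih =>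
    by_cases hx : x = 0
    · subst hx
      have := sumE hv he t (fun q => f (q + 1))
      simp only [ins, he, List.map_append, List.map_map, List.sum_append, Function.comp_def,
        tst_zero, if_true, this]
      rcases h : t.count 0 with _ | p <;>
      simp [tst_even hv he, tst_zero, hv, Ro, Eo, h, List.count_cons] <;> ring
    · by_cases hx2 : Even x
      · simp [ins, hx, Function.comp_def, tst_even hx hx2]
      · simp [ins, hx, Function.comp_def, tst_odd hx2, ih]

/-- all configurations -/
def L : ℕ → List (List ℕ)
  | 0 => [[]]
  | v + 1 => (L v).flatMap (ins (v + 1))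

def G (v s : ℕ) (f : ℕ → ℕ) : ℕ := ((L v).map (tst s f)).sum

theorem mem_ins_mem {v x : ℕ} {w c : List ℕ} (h : c ∈ ins v w) (hx : x ∈ c) :
    x = v ∨ x = 0 ∨ x ∈ w := by
  induction w generalizing c with
  | nil => 
    simp only [ins] at h
    split_ifs at h <;> simp at h
    · rcases h with rfl | rfl <;> simp at hx <;> tauto
    · subst h; simp at hx; tauto
  | cons y t ih =>
    simp only [ins, List.mem_append, List.mem_map] at h
    rcases h with h | ⟨c', hc', rfl⟩
    · split_ifs at h <;> simp at h
      · rcases h with rfl | rfl | rfl | rfl <;> simp at hx ⊢ <;> tauto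
      · subst h;  simp at hx ⊢ ; tauto
    · simp only [List.mem_cons] at hx ⊢
      rcases hx with rfl | hx
      · tauto
      · have := ih hc' hx; tauto

theorem L_le {v x : ℕ} {w : List ℕ} (h : w ∈ L v) (hx : x ∈ w) : x ≤ v := by
  induction v generalizing w with
  | zero => simp [L] at h; subst h; simp at hx
  | succ v ih =>
    simp only [L, List.mem_flatMap] at h
    obtain ⟨w', hw', h⟩ := h
    rcases mem_ins_mem h hx with h | h | h
    · omega
    · omega
    · have := ih hw' h; omega

theorem G_succ (v s s' : ℕ) (f g : ℕ → ℕ)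
    (h : ∀ w ∈ L v, ((ins (v+1) w).map (tst s f)).sum = tst s' g w) :
    G (v + 1) s f = G v s' g := by
  unfold G
  rw [L, List.map_flatMap, ← List.map_congr_left h]
  generalize L v = l
  induction l with
  | nil => simp
  | cons a l ih => simp [ih]

theorem G_other (m s : ℕ) (h0 : s ≠ 0) (hs : s ≠ 2 * m + 2) (f : ℕ → ℕ) :
    G (2 * m + 2) s f = G (2 * m) s (Oo (Eo f)) := by
  rw [G_succ (2*m+1) s s f (Eo f), G_succ (2*m) s s _ (Oo (Eo f))]
  · intro w _; exact sum_odd (by omega) (by simp [parity_simps]) _ _ _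
  · intro w _; exact sum_even_other (by omega) (by simp [parity_simps]) _ h0 hs _ _

theorem G_self (m : ℕ) (f : ℕ → ℕ) :
    G (2 * m + 2) (2 * m + 2) f = G (2 * m) 0 (Oo (Fo f)) := by
  rw [G_succ (2*m+1) _ 0 f (Fo f), G_succ (2*m) _ 0 _ (Oo (Fo f))]
  · intro w _; exact sum_odd (by omega) (by simp [parity_simps]) _ _ _
  · intro w hw; exact sum_even_self (by omega) (by simp [parity_simps]) _ _
      (fun h => by have := L_le hw h; omega)

theorem G_zero (m : ℕ) (f : ℕ → ℕ) :
    G (2 * m + 2) 0 f = G (2 * m) 0 (Oo (Ro f)) := by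
  rw [G_succ (2*m+1) _ 0 f (Ro f), G_succ (2*m) _ 0 _ (Oo (Ro f))]
  · intro w _; exact sum_odd (by omega) (by simp [parity_simps]) _ _ _
  · intro w hw; exact sum_even_zero (by omega) (by simp [parity_simps]) _ _

theorem tst_add (s : ℕ) (f g : ℕ → ℕ) (w) : tst s (fun p => f p + g p) w = tst s f w + tst s g w := by
  unfold tst; split_ifs <;> simp

theorem G_add (v s : ℕ) (f g : ℕ → ℕ) : G v s (fun p => f p + g p) = G v s f + G v s g := by
  unfold G; rw [← List.sum_map_add]; congr 1; exact List.map_congr_left (fun w _ => tst_add s f g w)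

theorem OFR (f : ℕ → ℕ) : (fun p => Oo (Fo f) p + Oo (Ro f) p) = Oo (Eo f) := by
  ext p
  rcases p with _ | p <;> simp [Oo, Fo, Ro, Eo] ; ring

theorem key (f : ℕ → ℕ) : Oo (Ro (Oo (Fo f))) = fun p => Oo (Fo (Oo (Eo f))) p + Oo (Eo f) p := by
  ext p
  rcases p with _ | _ | p <;> simp [Oo, Fo, Ro, Eo] <;> ring

/-- sum side -/
def T (k m : ℕ) (f : ℕ → ℕ) : ℕ := ∑ i ∈ Finset.Ico k (m + 1), G (2 * m) (2 * i) f + G (2 * m) 0 f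

theorem T_succ (k m : ℕ) (hk : 1 ≤ k) (hm : k ≤ m + 1) (f : ℕ → ℕ) :
    T k (m + 1) f = T k m (Oo (Eo f)) := by
  unfold T
  rw [Finset.sum_Ico_succ_top hm, show 2 * (m+1) = 2 * m + 2 by ring, G_self, G_zero, add_assoc,
    ← G_add, OFR]
  congr 1
  apply Finset.sum_congr rfl
  intro i hi
  simp at hi
  exact G_other _ _ (by omega) (by omega) _

theorem recpos (k m : ℕ) (hk : 1 ≤ k) (hm : k ≤ m) : ∀ f,
    G (2 * m + 2) (2 * k + 2) f = G (2 * m + 2) (2 * k) f + T k m f := by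
  induction m, hm using Nat.le_induction with
  | base =>
    intro f
    obtain ⟨j, rfl⟩ : ∃ j, k = j + 1 := ⟨k - 1, by omega⟩
    rw [G_self, G_other _ _ (by omega) (by omega), T_succ _ _ hk le_rfl]
    rw [show 2 * (j+1) = 2 * j + 2 by ring, G_zero, G_self, key, G_add]
    simp [T]
  | succ m hm ih =>
    intro f
    rw [G_other _ _ (by omega) (by omega), G_other _ _ (by omega) (by omega),
      T_succ _ _ hk (by omega)]
    exact ih _

theorem reczero (m : ℕ) : ∀ f,
    G (2 * m + 2) 2 f = T 1 m f := by
  induction m with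
  | zero =>
    intro f
    rw [show (2:ℕ) = 2 * 0 + 2 by ring]
    rw [G_self]
    simp [G, L, T, tst, st, Oo, Fo]
  | succ m ih =>
    intro f
    rw [G_other _ _ (by omega) (by omega), T_succ _ _ le_rfl (by omega)]
    exact ih _

def dl (p : ℕ) : ℕ := if p = 0 then 1 else 0

theorem G_zero_dl (m : ℕ) : G (2 * m + 2) 0 dl = 0 := by
  have : Ro dl = fun _ => 0 := by ext p; rcases p with _ | _ | p <;> simp [Ro, dl]
  rw [G_zero, this]
  have : tst 0 (Oo fun _ => 0) = fun _ => 0 := by ext w; simp [tst, Oo]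
  simp [G, this]

theorem main_alg (n k : ℕ) (hn : 2 ≤ n) (hk : k < n) :
    G (2 * n) (2 * k + 2) dl = G (2 * n) (2 * k) dl +
      ∑ i ∈ Finset.Icc k (n - 1), G (2 * n - 2) (2 * i) dl := by
  obtain ⟨m, rfl⟩ : ∃ m, n = m + 2 := ⟨n - 2, by omega⟩
  have e : 2 * (m + 2) - 2 = 2 * (m + 1) := by omega
  have e2 : Finset.Icc k (m + 2 - 1) = Finset.Ico k (m + 1 + 1) := by ext; simp
  have e3 := G_zero_dl m
  have e4 := G_zero_dl (m+1)
  rw [e, e2, show 2 * (m+2) = 2 * (m + 1) + 2 by ring]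
  rcases Nat.eq_zero_or_pos k with rfl | h
  · rw [Finset.sum_eq_sum_Ico_succ_bot (by omega)]
    have := reczero (m+1) dl
    simp only [T] at this
    simp only [mul_zero, zero_add]
    rw [this, e4, show 2 * (m+1) = 2 * m + 2 by ring, e3]; simp
  · have := recpos k (m+1) h (by omega) dl
    rw [this, T, show 2 * (m+1) = 2 * m + 2 by ring, e3]; simp

theorem Hd_zero_cons {y : ℕ} {t : List ℕ} (h : Hd 0 (y :: t)) : y ≠ 0 ∧ Even y := h.1 rfl

def del (v : ℕ) : List ℕ → List ℕ
  | [] => []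
  | x :: t =>
    if x = v then (match t with
      | [] => []
      | y :: t' => if y = 0 then 0 :: t' else 0 :: y :: t')
    else if x = 0 ∧ t.head? = some v then del v t
    else x :: del v t

theorem del_other {v x : ℕ} {t : List ℕ} (h : x ≠ v) (h2 : ¬ (x = 0 ∧ t.head? = some v)) :
    del v (x :: t) = x :: del v t := by
  rw [del.eq_def]; simp only [h, h2, if_false]

theorem ins_zero {v : ℕ} {t c : List ℕ} (h : c ∈ ins v (0 :: t)) :
    (Even v ∧ (c = v :: t ∨ c = v :: 0 :: t ∨ c = 0 :: v :: t ∨ c = 0 :: v :: 0 :: t)) ∨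
    c = v :: 0 :: t ∨ ∃ c' ∈ ins v t, c = 0 :: c' := by
  rw [ins, List.mem_append, List.mem_map] at h
  rcases h with h | ⟨c', hc', rfl⟩
  · by_cases he : Even v <;> simp [he] at h
    · exact Or.inl ⟨he, h⟩
    · exact Or.inr (Or.inl h)
  · exact Or.inr (Or.inr ⟨c', hc', rfl⟩)

theorem ins_head {v y : ℕ} {t c : List ℕ} (hy : y ≠ 0) (h : c ∈ ins v (y :: t)) :
    ∃ c', c = y :: c' ∧ c' ∈ ins v t := by
  simp [ins, hy] at h
  obtain ⟨a, h1, rfl⟩ := h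
  exact ⟨a, rfl, h1⟩

theorem Ok_zero {t : List ℕ} (h : Ok (0 :: t)) :
    ∃ y t', t = y :: t' ∧ y ≠ 0 ∧ Even y := by
  rcases t with _ | ⟨y, t'⟩
  · exact absurd rfl h.1
  · exact ⟨y, t', rfl, Hd_zero_cons h.1⟩

theorem del_ins {v : ℕ} (hv : v ≠ 0) (w : List ℕ) : ∀ c, Ok w → v ∉ w → c ∈ ins v w →
    del v c = w := by
  induction w with
  | nil =>
    intro c _ _ h
    simp only [ins] at h
    split_ifs at h <;> simp at h
    · rcases h with rfl | rfl <;> simp [del, hv.symm]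
    · subst h; simp [del]
  | cons x t ih =>
    intro c ho hw h
    simp only [List.mem_cons, not_or] at hw
    by_cases hx : x = 0
    · subst hx
      obtain ⟨y, t', rfl, hy, hy2⟩ := Ok_zero ho
      rcases ins_zero h with ⟨he, h⟩ | rfl | ⟨c', hc', rfl⟩
      · rcases h with rfl | rfl | rfl | rfl <;> simp [del, hv.symm, hy]
      · simp [del]
      · have e := ih c' ho.2 hw.2 hc'
        obtain ⟨c'', rfl, _⟩ := ins_head hy hc'
        simp only [List.mem_cons, not_or] at hw
        rw [del_other hv.symm (by simp [Ne.symm hw.2.1]), e]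
    · obtain ⟨c', rfl, hc'⟩ := ins_head hx h
      rw [del_other (Ne.symm hw.1) (by simp [hx]), ih c' ho.2 hw.2 hc']

theorem ins_nodup {v : ℕ} (hv : v ≠ 0) (w : List ℕ) : Ok w → v ∉ w → (ins v w).Nodup := by
  induction w with
  | nil =>
    intro _ _
    simp only [ins]
    split_ifs <;> simp [hv]
  | cons x t ih =>
    intro ho hw
    simp only [List.mem_cons, not_or] at hw
    have h1 : ((ins v t).map (fun c => x :: c)).Nodup :=
      (ih ho.2 hw.2).map (fun a b h => by simpa using h)
    by_cases hx : x = 0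
    · subst hx
      obtain ⟨y, t', rfl, hy, hy2⟩ := Ok_zero ho
      simp only [List.mem_cons, not_or] at hw
      rw [ins, List.nodup_append]
      refine ⟨?_, h1, ?_⟩
      · simp only [if_true]; split_ifs <;> simp [hv, hv.symm, hy, hy.symm]
      · intro a ha b hb hab
        subst hab
        simp only [List.mem_map] at hb
        obtain ⟨c, hc, rfl⟩ := hb
        obtain ⟨c'', rfl, _⟩ := ins_head hy hc
        simp only [if_true] at ha
        split_ifs at ha <;> simp [hv, hv.symm, hw.2.1, Ne.symm hw.2.1] at ha
    · simpa [ins, hx] using h1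

theorem Ok_ins {v : ℕ} (hv : v ≠ 0) (w : List ℕ) : ∀ c, Ok w → (∀ x ∈ w, x < v) → c ∈ ins v w →
    Ok c := by
  induction w with
  | nil =>
    intro c _ _ h
    simp only [ins] at h
    split_ifs at h with he <;> simp at h
    · rcases h with rfl | rfl <;> simp [Ok, Hd, hv, he]
    · subst h; simp [Ok, Hd, hv]
  | cons x t ih =>
    intro c ho hw h
    by_cases hx : x = 0
    · subst hx
      obtain ⟨y, t', rfl, hy, hy2⟩ := Ok_zero ho
      have ho' := ho
      simp only [Ok] at ho'
      have a1 : ∀ l, Hd v (0 :: l) := by intro l; simp [Hd, hv]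
      rcases ins_zero h with ⟨he, h⟩ | rfl | ⟨c', hc', rfl⟩
      · have a2 : ∀ l, Hd 0 (v :: l) := by intro l; simp [Hd, hv, he]
        have a3 : Hd v (y :: t') := by simp [Hd, hv, he, hy2]
        rcases h with rfl | rfl | rfl | rfl <;> simp [Ok, a1, a2, a3, ho']
      · simp [Ok, a1, ho']
      · have e := ih c' ho.2 (fun x hx => hw x (by simp [hx])) hc'
        obtain ⟨c'', rfl, _⟩ := ins_head hy hc'
        exact ⟨ho.1, e⟩
    · obtain ⟨c', rfl, hc'⟩ := ins_head hx h
      have e := ih c' ho.2 (fun x hx => hw x (by simp [hx])) hc'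
      refine ⟨?_, e⟩
      have hxv := hw x (by simp)
      have hH := ho.1
      have k0 : ∀ l, Hd x (0 :: l) := by intro l; simp [Hd, hx]
      have kv : ∀ l, Hd x (v :: l) := by intro l; simp [Hd, hx]; omega
      rcases t with _ | ⟨y, t⟩
      · simp only [ins] at hc'
        split_ifs at hc' <;> simp at hc'
        · rcases hc' with rfl | rfl <;> simp [k0, kv]
        · subst hc'; simp [kv]
      · by_cases hy : y = 0
        · subst hy
          rcases ins_zero hc' with ⟨_, hc'⟩ | rfl | ⟨c', hc', rfl⟩
          · rcases hc' with rfl | rfl | rfl | rfl <;> simp [k0, kv]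
          · simp [kv]
          · exact k0 _
        · obtain ⟨c'', rfl, _⟩ := ins_head hy hc'
          exact hH

theorem count_ins {v : ℕ} (w : List ℕ) : ∀ c, c ∈ ins v w → ∀ x, x ≠ 0 →
    c.count x = w.count x + if x = v then 1 else 0 := by
  induction w with
  | nil =>
    intro c h x hx
    simp only [ins] at h
    split_ifs at h with he <;> simp at h
    · rcases h with rfl | rfl <;> simp [List.count_cons, hx.symm, @eq_comm _ x v]
    · subst h; simp [List.count_cons, hx.symm, @eq_comm _ x v]
  | cons y t ih =>
    intro c h x hx
    simp only [ins, List.mem_append, List.mem_map] at h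
    rcases h with h | ⟨c', hc', rfl⟩
    · split_ifs at h with h1 he <;> simp at h <;> subst h1
      · rcases h with rfl | rfl | rfl | rfl <;> simp [List.count_cons, hx.symm, @eq_comm _ x v]
      · subst h; simp [List.count_cons, hx.symm, @eq_comm _ x v]
    · simp only [List.count_cons, ih c' hc' x hx]; omega

theorem del_spec {v : ℕ} (hv : v ≠ 0) (c : List ℕ) : Ok c → (∀ x ∈ c, x ≤ v) → c.count v = 1 →
    c ∈ ins v (del v c) ∧ Ok (del v c) := by
  induction c with
  | nil => intro _ _ h; simp at h
  | cons x t ih =>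
    intro ho hl hc
    have base : ∀ t, Ok (v :: t) → (∀ x ∈ t, x ≤ v) → t.count v = 0 →
        (v :: t ∈ ins v (del v (v :: t)) ∧ (Even v → 0 :: v :: t ∈ ins v (del v (v :: t)))) ∧
          Ok (del v (v :: t)) := by
      intro t ho hl hc
      rcases t with _ | ⟨y, t⟩
      · simp [del, ins, Ok]; constructor
        · split_ifs <;> simp
        · intro h; simp [h]
      · have hyv : y ≠ v := by rintro rfl; simp at hc
        have := hl y (by simp)
        by_cases hy : y = 0
        · subst hy
          simp only [del, if_true, ho.2, and_true, ins]
          constructor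
          · split_ifs <;> simp
          · intro h; simp [h]
        · have h2 := ho.1.2 hy (by omega)
          have h3 : Ok (0 :: y :: t) := ⟨⟨fun _ => ⟨hy, h2.2⟩, by simp⟩, ho.2⟩
          simp [del, hy, h3, ins, h2.1]
    by_cases hxv : x = v
    · subst hxv
      have := base t ho (fun y hy => hl y (by simp [hy])) (by simpa using hc)
      exact ⟨this.1.1, this.2⟩
    have hc' : t.count v = 1 := by simpa [List.count_cons, hxv] using hc
    by_cases hx0 : x = 0 ∧ t.head? = some v
    · obtain ⟨rfl, h⟩ := hx0
      rcases t with _ | ⟨y, t⟩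
      · simp at h
      simp at h; subst h
      have := base t ho.2 (fun y hy => hl y (by simp [hy])) (by simpa using hc')
      rw [del]; simp only [hxv, if_false, List.head?_cons, and_self, if_true]
      exact ⟨this.1.2 (Hd_zero_cons ho.1).2, this.2⟩
    · have := ih ho.2 (fun y hy => hl y (by simp [hy])) hc'
      rw [del_other hxv hx0]
      refine ⟨by simp [ins, this.1], ?_, this.2⟩
      have hH := ho.1
      rcases t with _ | ⟨y, t⟩
      · simp at hc'
      by_cases hyv : y = v
      · subst hyv
        have hx : x ≠ 0 := by rintro rfl; simp at hx0
        rcases t with _ | ⟨z, t⟩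
        · simpa [del, Hd] using hx
        · by_cases hz : z = 0 <;> simp [del, hz, Hd, hx]
      · by_cases hy0 : y = 0 ∧ t.head? = some v
        · obtain ⟨rfl, h⟩ := hy0
          have hx : x ≠ 0 := by rintro rfl; exact (Hd_zero_cons hH).1 rfl
          rcases t with _ | ⟨z, t⟩
          · simp at h
          simp at h; subst h
          rcases t with _ | ⟨z', t⟩
          · simpa [del, Hd, hyv] using hx
          · by_cases hz : z' = 0 <;> simp [del, hz, Hd, hx, hyv]
        · rw [del_other hyv hy0]
          exact hH

def Valid (v : ℕ) (w : List ℕ) : Prop :=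
  Ok w ∧ ∀ x, x ≠ 0 → w.count x = if x ≤ v then 1 else 0

theorem Valid.le {v : ℕ} {w : List ℕ} (h : Valid v w) : ∀ x ∈ w, x ≤ v := by
  intro x hx
  rcases Nat.eq_zero_or_pos x with rfl | h0
  · omega
  have := h.2 x (by omega)
  have h2 := List.count_pos_iff.2 hx
  by_contra h3
  simp [h3] at this
  omega

theorem mem_L (v : ℕ) : ∀ w, w ∈ L v ↔ Valid v w := by
  induction v with
  | zero =>
    intro w
    simp only [L, List.mem_singleton]
    constructor
    · rintro rfl; refine ⟨trivial, fun x hx => ?_⟩; simp [hx]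
    · intro h
      have hl := h.le
      rcases w with _ | ⟨x, t⟩
      · rfl
      · have := hl x (by simp)
        obtain rfl : x = 0 := by omega
        obtain ⟨y, t', rfl, hy, _⟩ := Ok_zero h.1
        have := hl y (by simp)
        omega
  | succ v ih =>
    intro c
    simp only [L, List.mem_flatMap]
    constructor
    · rintro ⟨w, hw, hc⟩
      rw [ih] at hw
      refine ⟨Ok_ins (by omega) w c hw.1 (fun x hx => Nat.lt_succ_of_le (hw.le x hx)) hc, ?_⟩
      intro x hx
      rw [count_ins w c hc x hx, hw.2 x hx]
      split_ifs <;> omega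
    · intro h
      have := del_spec (v := v + 1) (by omega) c h.1 h.le (by rw [h.2 _ (by omega)]; simp)
      refine ⟨_, (ih _).2 ⟨this.2, ?_⟩, this.1⟩
      intro x hx
      have h1 := count_ins _ _ this.1 x hx
      rw [h.2 x hx] at h1
      split_ifs at h1 ⊢ <;> omega

theorem L_nodup (v : ℕ) : (L v).Nodup := by
  induction v with
  | zero => simp [L]
  | succ v ih =>
    rw [L, List.nodup_flatMap]
    have hn : ∀ w ∈ L v, v + 1 ∉ w := fun w hw h => by have := L_le hw h; omega
    refine ⟨fun w hw => ins_nodup (by omega) w ((mem_L v w).1 hw).1 (hn w hw), ?_⟩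
    refine List.Pairwise.imp_of_mem ?_ ih
    intro a b ha hb hab c hca hcb
    apply hab
    rw [← del_ins (by omega) a c ((mem_L v a).1 ha).1 (hn a ha) hca,
      ← del_ins (by omega) b c ((mem_L v b).1 hb).1 (hn b hb) hcb]

theorem G_card (v s : ℕ) :
    G v s dl = Nat.card {w : List ℕ // w ∈ L v ∧ st w = s ∧ w.count 0 = 0} := by
  have h1 : G v s dl = ((L v).filter (fun w => st w = s ∧ w.count 0 = 0)).length := by
    unfold G
    generalize L v = l
    induction l with
    | nil => simp
    | cons a l ih =>
      rw [List.map_cons, List.sum_cons, ih, List.filter_cons]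
      by_cases h : st a = s <;> by_cases h2 : a.count 0 = 0
      · simp [tst, dl, h, h2]; omega
      · simp [tst, dl, h, h2]
      · simp [tst, dl, h, h2]
      · simp [tst, dl, h, h2]
  rw [h1, ← List.toFinset_card_of_nodup ((L_nodup v).filter _), ← Nat.card_eq_finsetCard]
  apply Nat.card_congr
  apply Equiv.subtypeEquivRight
  intro w; simp

theorem Ok_iff (w : List ℕ) (h0 : 0 ∉ w) : Ok w ↔ ∀ i j (hi : i < w.length) (hj : j < w.length),
    i + 1 = j → w[j] < w[i] → Even w[i] ∧ Even w[j] := by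
  induction w with
  | nil => simp [Ok]
  | cons x t ih =>
    simp only [List.mem_cons, not_or] at h0
    rw [Ok, ih h0.2]
    constructor
    · rintro ⟨h1, h2⟩ i j hi hj rfl hlt
      rcases i with _ | i
      · rcases t with _ | ⟨y, t⟩
        · simp at hj
        · simp only [List.mem_cons, not_or] at h0
          exact h1.2 (Ne.symm h0.2.1) hlt
      · exact h2 i (i+1) (by simpa using hi) (by simpa using hj) rfl hlt
    · intro h
      constructor
      · rcases t with _ | ⟨y, t⟩
        · exact Ne.symm h0.1
        · exact ⟨fun h => absurd h.symm h0.1, fun _ hlt => h 0 1 (by simp) (by simp) rfl hlt⟩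
      · intro i j hi hj hij hlt
        exact h (i+1) (j+1) (by simpa using hi) (by simpa using hj) (by omega) hlt

theorem st_iff (s : ℕ) (h0 : s ≠ 0) (hs : Even s) (w : List ℕ) :
    st w = s ↔ ∃ i, ∃ hi : i < w.length, w[i] = s ∧ ∀ j (hj : j < i), Odd (w[j]) := by
  induction w with
  | nil => simp [st, h0.symm]
  | cons x t ih =>
    by_cases hx : Even x
    · simp only [st, hx, if_true]
      constructor
      · intro h; exact ⟨0, by simp, h, by simp⟩
      · rintro ⟨i, hi, h1, h2⟩
        rcases i with _ | i
        · exact h1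
        · have := h2 0 (by omega)
          simp at this
          exact absurd hx (Nat.not_even_iff_odd.2 this)
    · simp only [st, hx, if_false, ih]
      constructor
      · rintro ⟨i, hi, h1, h2⟩
        refine ⟨i+1, by simpa using hi, h1, ?_⟩
        intro j hj
        rcases j with _ | j
        · exact Nat.not_even_iff_odd.1 hx
        · exact h2 j (by omega)
      · rintro ⟨i, hi, h1, h2⟩
        rcases i with _ | i
        · simp at h1; subst h1; exact absurd hs hx
        · exact ⟨i, by simpa using hi, h1, fun j hj => h2 (j+1) (by omega)⟩

def word {N : ℕ} (σ : Equiv.Perm (Fin N)) : List ℕ := List.ofFn (fun i => (σ i : ℕ) + 1)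

theorem word_zero {N : ℕ} (σ : Equiv.Perm (Fin N)) : 0 ∉ word σ := by
  simp [word, List.mem_ofFn]

theorem word_count {N : ℕ} (σ : Equiv.Perm (Fin N)) (x : ℕ) (hx : x ≠ 0) :
    (word σ).count x = if x ≤ N then 1 else 0 := by
  have hn : (word σ).Nodup := by
    rw [word, List.nodup_ofFn]
    intro i j h
    simpa [Fin.val_inj] using h
  split_ifs with h
  · apply List.count_eq_one_of_mem hn
    rw [word, List.mem_ofFn]
    exact ⟨σ.symm ⟨x - 1, by omega⟩, by simp; omega⟩
  · rw [List.count_eq_zero, word, List.mem_ofFn]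
    rintro ⟨i, hi⟩
    have := (σ i).2
    omega

theorem word_Ok {N : ℕ} (σ : Equiv.Perm (Fin N)) : Ok (word σ) ↔ IsDIII σ := by
  rw [Ok_iff _ (word_zero σ)]
  constructor
  · intro h i j hij hlt
    have := h i j (by simp [word]) (by simp [word]) hij
    simp [word] at this
    simpa using this hlt
  · intro h i j hi hj hij hlt
    simp [word] at hi hj hlt ⊢
    exact h ⟨i, hi⟩ ⟨j, hj⟩ hij hlt

theorem word_st {N : ℕ} (σ : Equiv.Perm (Fin N)) (s : ℕ) (h0 : s ≠ 0) (hs : Even s) :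
    st (word σ) = s ↔ LeftmostEvenIs σ s := by
  rw [st_iff s h0 hs]
  constructor
  · rintro ⟨i, hi, h1, h2⟩
    have hi' : i < N := by simpa [word] using hi
    refine ⟨⟨i, hi'⟩, by simpa [word] using h1, fun j hj => ?_⟩
    have := h2 j hj
    simpa [word] using this
  · rintro ⟨i, h1, h2⟩
    refine ⟨i, by simp [word], by simpa [word] using h1, fun j hj => ?_⟩
    have := h2 ⟨j, by omega⟩ hj
    simpa [word] using this

theorem word_surj {N : ℕ} (w : List ℕ) (h : Valid N w) (h0 : w.count 0 = 0) :
    ∃ σ : Equiv.Perm (Fin N), word σ = w := by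
  have hc : ∀ x, w.count x = (word (Equiv.refl (Fin N))).count x := by
    intro x
    by_cases hx : x = 0
    · subst hx; rw [h0, eq_comm, List.count_eq_zero]; exact word_zero _
    · rw [h.2 x hx, word_count _ x hx]
  have hp : w.Perm (word (Equiv.refl (Fin N))) := List.perm_iff_count.2 hc
  have hl : w.length = N := by rw [hp.length_eq]; simp [word]
  have hn : w.Nodup := by
    rw [hp.nodup_iff, word, List.nodup_ofFn]
    intro i j h
    simpa [Fin.val_inj] using h
  have hpos : ∀ i (hi : i < w.length), w[i] ≠ 0 ∧ w[i] ≤ N := by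
    intro i hi
    refine ⟨fun h1 => ?_, h.le _ (List.getElem_mem hi)⟩
    rw [List.count_eq_zero] at h0
    exact h0 (h1 ▸ List.getElem_mem hi)
  let g : Fin N → Fin N := fun i => ⟨w[(i:ℕ)]'(by omega) - 1, by
    have := hpos i (by omega); omega⟩
  have hg : Function.Injective g := by
    intro i j hij
    simp only [g, Fin.mk.injEq] at hij
    have h1 := hpos i (by omega)
    have h2 := hpos j (by omega)
    have h3 : w[(i:ℕ)]'(by omega) = w[(j:ℕ)]'(by omega) := by omega
    exact Fin.ext ((hn.getElem_inj_iff).1 h3)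
  refine ⟨Equiv.ofBijective g (Finite.injective_iff_bijective.1 hg), ?_⟩
  apply List.ext_getElem
  · simp [word, hl]
  · intro i h1 h2
    have := hpos i h2
    simp [word, g]
    omega

theorem card_eq_pos (N s : ℕ) (h0 : s ≠ 0) (hs : Even s) :
    Nat.card {σ : Equiv.Perm (Fin N) // IsDIII σ ∧ LeftmostEvenIs σ s} = G N s dl := by
  rw [G_card]
  refine Nat.card_eq_of_bijective (fun σ => ⟨word σ.1, ?_, ?_, ?_⟩) ⟨?_, ?_⟩
  · exact (mem_L _ _).2 ⟨(word_Ok _).2 σ.2.1, word_count _⟩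
  · exact (word_st _ s h0 hs).2 σ.2.2
  · exact List.count_eq_zero.2 (word_zero _)
  · rintro ⟨σ, hσ⟩ ⟨τ, hτ⟩ h
    simp only [Subtype.mk.injEq, word] at h
    have := List.ofFn_injective h
    ext i
    have := congrFun this i
    simpa using this
  · rintro ⟨w, h1, h2, h3⟩
    have hV := (mem_L _ _).1 h1
    obtain ⟨σ, rfl⟩ := word_surj w hV h3
    exact ⟨⟨σ, (word_Ok _).1 hV.1, (word_st _ s h0 hs).1 h2⟩, rfl⟩

theorem card_eq (m k : ℕ) :
    Nat.card {σ : Equiv.Perm (Fin (2 * m + 2)) // IsDIII σ ∧ LeftmostEvenIs σ (2 * k)} =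
      G (2 * m + 2) (2 * k) dl := by
  rcases Nat.eq_zero_or_pos k with rfl | hk
  · rw [mul_zero, G_zero_dl, Nat.card_eq_zero]
    left
    constructor
    rintro ⟨σ, _, i, hi, _⟩
    omega
  · exact card_eq_pos _ _ (by omega) (by simp)

end DIII

/-- For all `n ≥ 2` and `0 ≤ k < n`,
`|D^III_{2n,2k+2}| = |D^III_{2n,2k}| + Σ_{i=k}^{n-1} |D^III_{2n-2,2i}|`
(with `|D^III_{2m,0}| = 0` by convention: no entry can equal `0`). -/
theorem card_DIII_even_rec (n k : ℕ) (hn : 2 ≤ n) (hk : k < n) :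
    Nat.card {σ : Equiv.Perm (Fin (2 * n)) // IsDIII σ ∧ LeftmostEvenIs σ (2 * k + 2)} =
      Nat.card {σ : Equiv.Perm (Fin (2 * n)) // IsDIII σ ∧ LeftmostEvenIs σ (2 * k)} +
      ∑ i ∈ Finset.Icc k (n - 1),
        Nat.card {σ : Equiv.Perm (Fin (2 * n - 2)) // IsDIII σ ∧ LeftmostEvenIs σ (2 * i)} := by
  rw [← mul_add_one 2 k]
  obtain ⟨m, rfl⟩ : ∃ m, n = m + 2 := ⟨n - 2, by omega⟩
  have e1 : ∀ k, Nat.card {σ : Equiv.Perm (Fin (2 * (m + 2))) //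
      IsDIII σ ∧ LeftmostEvenIs σ (2 * k)} = DIII.G (2 * (m + 2)) (2 * k) DIII.dl :=
    fun k => DIII.card_eq (m + 1) k
  have e2 : ∀ k, Nat.card {σ : Equiv.Perm (Fin (2 * (m + 2) - 2)) //
      IsDIII σ ∧ LeftmostEvenIs σ (2 * k)} = DIII.G (2 * (m + 2) - 2) (2 * k) DIII.dl :=
    fun k => DIII.card_eq m k
  simp only [e1, e2]
  exact DIII.main_alg (m + 2) k hn hk
end

section
/- For all n ≥ 1 and all 1 ≤ k ≤ n, the number of permutations in G^I_{2n} whose first letter is 2k equals the number of Dumont permutations of the third kind of {1,…,2n} whose leftmost even entry is 2k; that is, |G^I_{2n,2k}| = |D^III_{2n,2k}|. -/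
namespace Foata
open Equiv

inductive FE {α : Type*} (P : α → Prop) (σ : Perm α) : α → α → Prop
  | base (a : α) : P (σ a) → FE P σ a (σ a)
  | step (a c : α) : ¬ P (σ a) → FE P σ (σ a) c → FE P σ a c

theorem FE.unique {α : Type*} {P : α → Prop} {σ : Perm α} {a c d : α}
    (h : FE P σ a c) (h' : FE P σ a d) : c = d := by
  induction h with
  | base a hp =>
    cases h' with
    | base _ => rfl
    | step _ _ hn _ => exact absurd hp hn
  | step a c hn h ih =>
    cases h' with
    | base _ hp => exact absurd hp hn
    | step _ _ _ h => exact ih h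

theorem byp_apply {α : Type*} [DecidableEq α] (σ : Perm α) (v x : α) :
    (swap v (σ v) * σ) x = if x = v then v else if σ x = v then σ v else σ x := by
  rw [Perm.mul_apply, swap_apply_def]
  have : σ x = σ v ↔ x = v := σ.injective.eq_iff
  grind

theorem fe_byp {α : Type*} [DecidableEq α] {P : α → Prop} (σ : Perm α) (v : α) (hv : ¬ P v)
    (a c : α) (h : FE P σ a c) : ∀ a', a' ≠ v → (a' = a ∨ (a = v ∧ σ a' = v)) →
      FE P (swap v (σ v) * σ) a' c := by
  induction h with
  | base a hp =>
    intro a' h1 h2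
    have e : (swap v (σ v) * σ) a' = σ a := by
      rw [byp_apply]; grind
    rw [← e]; apply FE.base; rwa [e]
  | step a c hn h ih =>
    intro a' h1 h2
    by_cases h3 : a' = a
    · subst h3
      by_cases h4 : σ a' = v
      · exact ih a' h1 (Or.inr ⟨h4, h4⟩)
      · have e : (swap v (σ v) * σ) a' = σ a' := by
          rw [byp_apply]; grind
        apply FE.step
        · rwa [e]
        · rw [e]; exact ih _ h4 (Or.inl rfl)
    · obtain ⟨h4, h5⟩ := h2.resolve_left h3
      subst h4
      have h6 : σ a ≠ a := fun h => h1 (σ.injective (h5.trans h.symm))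
      have e : (swap a (σ a) * σ) a' = σ a := by
        rw [byp_apply]; grind
      apply FE.step
      · rwa [e]
      · rw [e]; exact ih _ h6 (Or.inl rfl)

theorem fe_byp' {α : Type*} [DecidableEq α] {P : α → Prop} (σ : Perm α) (v : α) (hv : ¬ P v)
    (a c : α) (h : FE P (swap v (σ v) * σ) a c) : a ≠ v → FE P σ a c := by
  induction h with
  | base a hp =>
    intro h1
    by_cases h3 : σ a = v
    · have e : (swap v (σ v) * σ) a = σ v := by
        rw [byp_apply]; grind
      rw [e] at hp ⊢
      apply FE.step
      · rwa [h3]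
      · rw [h3]; exact FE.base _ hp
    · have e : (swap v (σ v) * σ) a = σ a := by
        rw [byp_apply]; grind
      rw [e] at hp ⊢
      exact FE.base _ hp
  | step a c hn h ih =>
    intro h1
    have h2 : (swap v (σ v) * σ) a ≠ v := by
      rw [byp_apply]
      have : σ v = v → σ a = v → a = v := fun h h' => σ.injective (h'.trans h.symm)
      grind
    have ih := ih h2
    by_cases h3 : σ a = v
    · have e : (swap v (σ v) * σ) a = σ v := by
        rw [byp_apply]; grind
      rw [e] at hn ih
      apply FE.step
      · rwa [h3]
      · rw [h3]; exact FE.step _ _ hn ih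
    · have e : (swap v (σ v) * σ) a = σ a := by
        rw [byp_apply]; grind
      rw [e] at hn ih
      exact FE.step _ _ hn ih

def U {m : ℕ} (P : Fin m → Prop) (σ : Perm (Fin m)) : Prop :=
  ∀ a, σ a < a → P a ∧ P (σ a)

def wt {m : ℕ} (σ : Perm (Fin m)) (v : Fin m) : ℕ :=
  (Finset.univ.filter fun a => a ≤ v ∧ v ≤ σ a).card

theorem wt_eq {m : ℕ} (σ : Perm (Fin m)) (v : Fin m) :
    wt σ v = (Finset.univ.filter fun b => σ⁻¹ b ≤ v ∧ v ≤ b).card := by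
  unfold wt
  apply Finset.card_nbij' (fun a => σ a) (fun b => σ⁻¹ b)
  · intro a; simp
  · intro a; simp
  · intro a; simp
  · intro a; simp

theorem wt_inv {m : ℕ} (σ : Perm (Fin m)) (v : Fin m) (hv : σ v = v) :
    wt σ⁻¹ v = wt σ v := by
  rw [wt_eq, wt]
  simp only [inv_inv]
  have h1 : (Finset.univ.filter fun a => a ≤ v).card
      = (Finset.univ.filter fun a => σ a ≤ v).card := by
    apply Finset.card_nbij' (fun a => σ⁻¹ a) (fun b => σ b)
    · intro a; simp
    · intro a; simp
    · intro a; simp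
    · intro a; simp
  have h2 := Finset.card_filter_add_card_filter_not (s := Finset.univ.filter fun a => a ≤ v)
    (fun a => v ≤ σ a)
  have h3 := Finset.card_filter_add_card_filter_not (s := Finset.univ.filter fun a => σ a ≤ v)
    (fun a => v ≤ a)
  simp only [Finset.filter_filter] at h2 h3
  have h4 : (Finset.univ.filter fun a => a ≤ v ∧ ¬ v ≤ σ a)
      = (Finset.univ.filter fun a => σ a ≤ v ∧ ¬ v ≤ a) := by
    ext a
    simp only [Finset.mem_filter, Finset.mem_univ, true_and, not_le]
    have h5 : σ a = v ↔ a = v := by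
      constructor
      · intro h; exact σ.injective (h.trans hv.symm)
      · rintro rfl; exact hv
    constructor
    · rintro ⟨h, h'⟩
      exact ⟨h'.le, lt_of_le_of_ne h (fun e => h'.ne (h5.2 e))⟩
    · rintro ⟨h, h'⟩
      exact ⟨h'.le, lt_of_le_of_ne h (fun e => h'.ne (h5.1 e))⟩
  rw [h4] at h2
  omega

theorem wt_byp {m : ℕ} (P : Fin m → Prop) (σ : Perm (Fin m)) (hU : U P σ) (v u : Fin m)
    (hv : ¬ P v) (huv : u ≠ v) : wt (swap v (σ v) * σ) u = wt σ u := by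
  have hb : v ≤ σ v := by
    by_contra h; exact hv (hU v (not_le.1 h)).1
  have ha : σ⁻¹ v ≤ v := by
    by_contra h
    have := (hU (σ⁻¹ v) (by simpa using h)).2
    simp at this; exact hv this
  rcases lt_or_gt_of_ne huv with h | h
  · unfold wt
    congr 1
    ext x
    simp only [Finset.mem_filter, Finset.mem_univ, true_and, byp_apply]
    by_cases h1 : x = v
    · subst h1; simp; omega
    · simp only [h1, if_false]
      split_ifs with h2
      · rw [h2]; omega
      · rfl
  · rw [wt_eq, wt_eq]
    congr 1
    ext x
    simp only [Finset.mem_filter, Finset.mem_univ, true_and, mul_inv_rev, swap_inv,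
      Perm.mul_apply, swap_apply_def]
    by_cases h1 : x = v
    · subst h1; simp; omega
    · simp only [h1, if_false]
      split_ifs with h2
      · subst h2
        have e : σ⁻¹ (σ v) = v := by simp
        rw [e]; omega
      · rfl

open Classical in
noncomputable def X {m : ℕ} (P : Fin m → Prop) (Q : Perm (Fin m) → Prop) (S : Finset (Fin m)) :
    Finset (Perm (Fin m)) :=
  Finset.univ.filter fun σ => U P σ ∧ Q σ ∧ ∀ v, ¬ P v → v ∉ S → σ v = v

open Classical in
noncomputable def T {m : ℕ} (P : Fin m → Prop) (Q : Perm (Fin m) → Prop) (S : Finset (Fin m)) : ℕ :=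
  ∑ σ ∈ X P Q S, ∏ v ∈ (Finset.univ.filter fun v => ¬ P v) \ S, wt σ v

theorem U_byp {m : ℕ} (P : Fin m → Prop) (σ : Perm (Fin m)) (hU : U P σ) (v : Fin m)
    (hv : ¬ P v) : U P (swap v (σ v) * σ) := by
  intro x
  have hb : v ≤ σ v := by
    by_contra h; exact hv (hU v (not_le.1 h)).1
  rw [byp_apply]
  by_cases h1 : x = v
  · subst h1; simp
  · simp only [h1, if_false]
    split_ifs with h2
    · intro h
      have : σ x < x := by rw [h2]; exact lt_of_le_of_lt hb h
      have := (hU x this).2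
      rw [h2] at this; exact absurd this hv
    · exact hU x

open Classical in
theorem fiber {m : ℕ} (P : Fin m → Prop) (Q : Perm (Fin m) → Prop)
    (hQ : ∀ σ v, U P σ → ¬ P v → (Q (swap v (σ v) * σ) ↔ Q σ))
    (S : Finset (Fin m)) (v : Fin m) (hv : ¬ P v) (hvS : v ∉ S)
    (τ : Perm (Fin m)) (hτ : τ ∈ X P Q S) :
    ((X P Q (insert v S)).filter fun σ => swap v (σ v) * σ = τ).card = wt τ v := by
  simp only [X, Finset.mem_filter, Finset.mem_univ, true_and] at hτ
  obtain ⟨hU, hq, hf⟩ := hτ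
  have hτv : τ v = v := hf v hv hvS
  symm
  unfold wt
  apply Finset.card_nbij' (fun a => swap v (τ a) * τ) (fun σ => τ⁻¹ (σ v))
  · intro a ha
    simp only [Finset.coe_filter, Finset.mem_univ, true_and, Set.mem_ofPred_eq, X,
      Finset.mem_filter] at ha ⊢
    obtain ⟨h1, h2⟩ := ha
    have e : (swap v (τ a) * τ) v = τ a := by simp [hτv]
    have hU' : U P (swap v (τ a) * τ) := by
      intro x
      rw [Perm.mul_apply, swap_apply_def]
      split_ifs with h3 h4
      · have : x = v := τ.injective (h3.trans hτv.symm)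
        intro h; omega
      · have : x = a := τ.injective h4
        intro h; omega
      · exact hU x
    have e2 : swap v ((swap v (τ a) * τ) v) * (swap v (τ a) * τ) = τ := by
      rw [e, ← mul_assoc, swap_mul_self, one_mul]
    refine ⟨⟨hU', ?_, ?_⟩, e2⟩
    · rw [← hQ _ v hU' hv, e2]; exact hq
    · intro u hu huS
      simp only [Finset.mem_insert, not_or] at huS
      have := hf u hu huS.2
      rw [Perm.mul_apply, this, swap_apply_of_ne_of_ne huS.1]
      intro h
      have : u = a := τ.injective (this.trans h)
      subst this
      apply huS.1; omega
  · intro σ hσ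
    simp only [Finset.coe_filter, Finset.mem_univ, true_and, Set.mem_ofPred_eq, X,
      Finset.mem_filter] at hσ ⊢
    obtain ⟨⟨h1, h2, h3⟩, h4⟩ := hσ
    constructor
    · have : τ⁻¹ (σ v) = σ⁻¹ v := by
        rw [← h4]; simp
      rw [this]
      by_contra h
      have := (h1 (σ⁻¹ v) (by simpa using h)).2
      simp at this; exact hv this
    · have e' : ∀ y, τ (τ⁻¹ y) = y := fun y => by simp
      simp only [e']
      by_contra h; exact hv (h1 v (not_le.1 h)).1
  · intro a ha
    simp [hτv]
  · intro σ hσ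
    simp only [Finset.coe_filter, Set.mem_ofPred_eq] at hσ
    have e' : ∀ y, τ (τ⁻¹ y) = y := fun y => by simp
    simp only [e']
    rw [← hσ.2, ← mul_assoc]
    simp

open Classical in
theorem T_insert {m : ℕ} (P : Fin m → Prop) (Q : Perm (Fin m) → Prop)
    (hQ : ∀ σ v, U P σ → ¬ P v → (Q (swap v (σ v) * σ) ↔ Q σ))
    (S : Finset (Fin m)) (v : Fin m) (hv : ¬ P v) (hvS : v ∉ S) :
    T P Q (insert v S) = T P Q S := by
  unfold T
  have hmap : ∀ σ ∈ X P Q (insert v S), swap v (σ v) * σ ∈ X P Q S := by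
    intro σ hσ
    simp only [X, Finset.mem_filter, Finset.mem_univ, true_and] at hσ ⊢
    obtain ⟨h1, h2, h3⟩ := hσ
    refine ⟨U_byp P σ h1 v hv, (hQ σ v h1 hv).2 h2, ?_⟩
    intro u hu huS
    rw [byp_apply]
    by_cases huv : u = v
    · simp [huv]
    · have := h3 u hu (by simp [huv, huS])
      simp [huv, this]
  rw [← Finset.sum_fiberwise_of_maps_to hmap]
  apply Finset.sum_congr rfl
  intro τ hτ
  have hins : (Finset.univ.filter fun v => ¬ P v) \ S
      = insert v ((Finset.univ.filter fun v => ¬ P v) \ insert v S) := by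
    ext x; simp only [Finset.mem_sdiff, Finset.mem_filter, Finset.mem_univ, true_and,
      Finset.mem_insert]
    by_cases hx : x = v
    · subst hx; simp [hv, hvS]
    · simp [hx]
  rw [hins, Finset.prod_insert (by simp), ← fiber P Q hQ S v hv hvS τ hτ, ← smul_eq_mul,
    ← Finset.sum_const]
  apply Finset.sum_congr rfl
  intro σ hσ
  apply Finset.prod_congr rfl
  intro u hu
  simp only [Finset.mem_filter] at hσ
  rw [← hσ.2, wt_byp P σ _ v u hv]
  · rintro rfl; simp at hu
  · have := hσ.1
    simp only [X, Finset.mem_filter] at this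
    exact this.2.1

open Classical in
theorem T_all {m : ℕ} (P : Fin m → Prop) (Q : Perm (Fin m) → Prop)
    (hQ : ∀ σ v, U P σ → ¬ P v → (Q (swap v (σ v) * σ) ↔ Q σ)) :
    Nat.card {σ : Perm (Fin m) // U P σ ∧ Q σ} = T P Q ∅ := by
  rw [Nat.card_eq_fintype_card, Fintype.card_subtype]
  have key : ∀ S : Finset (Fin m), (∀ v ∈ S, ¬ P v) → T P Q S = T P Q ∅ := by
    intro S
    induction S using Finset.induction_on with
    | empty => intro _; rfl
    | insert v S hvS ih =>
      intro h
      rw [T_insert P Q hQ S v (h v (by simp)) hvS]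
      exact ih fun u hu => h u (by simp [hu])
  rw [← key (Finset.univ.filter fun v => ¬ P v) (by simp)]
  unfold T X
  rw [Finset.card_eq_sum_ones]
  apply Finset.sum_congr
  · ext σ; simp
    intros; tauto
  · intro σ _; simp

open Classical in
theorem card_FE {m : ℕ} (P : Fin m → Prop) (z c : Fin m) (hz : P z) (hc : P c)
    (hmin : ∀ a, z ≤ a) :
    Nat.card {σ : Perm (Fin m) // U P σ ∧ FE P σ z c}
      = Nat.card {σ : Perm (Fin m) // U P σ ∧ σ c = z} := by
  rw [T_all P (fun σ => FE P σ z c), T_all P (fun σ => σ c = z)]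
  · unfold T
    apply Finset.sum_nbij' (fun σ => σ⁻¹) (fun σ => σ⁻¹)
    · intro σ
      simp only [X, Finset.mem_filter, Finset.mem_univ, true_and]
      rintro ⟨h1, h2, h3⟩
      have h3' : ∀ v, ¬ P v → σ v = v := fun v hv => h3 v hv (by simp)
      have h4 : P (σ z) := by
        by_contra h
        have := σ.injective (h3' _ h)
        rw [this] at h; exact h hz
      have h5 : c = σ z := FE.unique h2 (FE.base z h4)
      refine ⟨?_, ?_, ?_⟩
      · intro a ha
        by_cases hp : P a
        · refine ⟨hp, ?_⟩
          by_contra h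
          have := h3' _ h
          have e : σ (σ⁻¹ a) = a := by simp
          rw [this] at e
          rw [e] at h; exact h hp
        · have := h3' _ hp
          have : σ⁻¹ a = a := by rw [Perm.inv_eq_iff_eq, this]
          rw [this] at ha; exact absurd ha (lt_irrefl _)
      · rw [h5]; simp
      · intro v hv _
        rw [Perm.inv_eq_iff_eq, h3' v hv]
    · intro σ
      simp only [X, Finset.mem_filter, Finset.mem_univ, true_and]
      rintro ⟨h1, h2, h3⟩
      have h3' : ∀ v, ¬ P v → σ v = v := fun v hv => h3 v hv (by simp)
      refine ⟨?_, ?_, ?_⟩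
      · intro a ha
        by_cases hp : P a
        · refine ⟨hp, ?_⟩
          by_contra h
          have := h3' _ h
          have e : σ (σ⁻¹ a) = a := by simp
          rw [this] at e
          rw [e] at h; exact h hp
        · have := h3' _ hp
          have : σ⁻¹ a = a := by rw [Perm.inv_eq_iff_eq, this]
          rw [this] at ha; exact absurd ha (lt_irrefl _)
      · have : σ⁻¹ z = c := by rw [Perm.inv_eq_iff_eq, h2]
        rw [← this]; apply FE.base; rwa [this]
      · intro v hv _
        rw [Perm.inv_eq_iff_eq, h3' v hv]
    · intro σ _; simp
    · intro σ _; simp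
    · intro σ hσ
      apply Finset.prod_congr rfl
      intro v hv
      simp only [X, Finset.mem_filter, Finset.mem_univ, true_and] at hσ
      simp at hv
      rw [wt_inv]
      exact hσ.2.2 v hv (by simp)
  · intro σ v hU hv
    have hzv : z ≠ σ v := by
      intro h
      have h1 : v ≤ σ v := by
        by_contra h; exact hv (hU v (not_le.1 h)).1
      have : v = z := le_antisymm (h ▸ h1) (hmin v)
      exact hv (this ▸ hz)
    have hzv' : z ≠ v := by rintro rfl; exact hv hz
    have hcv : c ≠ v := by rintro rfl; exact hv hc
    simp only [byp_apply, hcv, if_false]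
    split_ifs with h
    · rw [h]; constructor
      · intro h; exact absurd h.symm hzv
      · intro h; exact absurd h.symm hzv'
    · rfl
  · intro σ v hU hv
    have hzv' : z ≠ v := by rintro rfl; exact hv hz
    exact ⟨fun h => fe_byp' σ v hv z c h hzv', fun h => fe_byp σ v hv z c h z hzv' (Or.inl rfl)⟩

def insQ {m : ℕ} (e : Perm (Fin m)) (p : Fin (m + 1)) : Fin (m + 1) :=
  Fin.cases (Fin.last m) (fun b => (e b).castSucc) p

def ins {m : ℕ} (x : Fin (m + 1) × Perm (Fin m)) : Perm (Fin (m + 1)) :=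
  (insQ x.2 x.1).cycleRange.symm * Perm.decomposeFin.symm (0, x.2)

theorem ins_zero {m : ℕ} (p : Fin (m + 1)) (e : Perm (Fin m)) : ins (p, e) 0 = insQ e p := by
  simp [ins]

theorem ins_succ {m : ℕ} (p : Fin (m + 1)) (e : Perm (Fin m)) (a : Fin m) :
    ((ins (p, e) a.succ : Fin (m + 1)) : ℕ) =
      if (e a : ℕ) < insQ e p then (e a : ℕ) else (e a : ℕ) + 1 := by
  simp only [ins, Perm.mul_apply, Perm.decomposeFin_symm_apply_succ, swap_self, refl_apply,
    Fin.cycleRange_symm_succ, Fin.succAbove, Fin.lt_def, Fin.val_castSucc]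
  split_ifs <;> simp

theorem insQ_inj {m : ℕ} (e : Perm (Fin m)) (p p' : Fin (m + 1)) (h : insQ e p = insQ e p') :
    p = p' := by
  induction p using Fin.cases with
  | zero =>
    induction p' using Fin.cases with
    | zero => rfl
    | succ b => simp [insQ, Fin.ext_iff] at h; omega
  | succ a =>
    induction p' using Fin.cases with
    | zero => simp [insQ, Fin.ext_iff] at h; omega
    | succ b => simpa [insQ] using h

theorem ins_bij {m : ℕ} : Function.Bijective (ins (m := m)) := by
  rw [Fintype.bijective_iff_injective_and_card]
  constructor
  · rintro ⟨p, e⟩ ⟨p', e'⟩ h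
    have h0 : insQ e p = insQ e' p' := by rw [← ins_zero, ← ins_zero, h]
    have h1 : e = e' := by
      simp only [ins, h0, mul_right_inj, EmbeddingLike.apply_eq_iff_eq, Prod.mk.injEq] at h
      exact h.2
    subst h1
    rw [insQ_inj e p p' h0]
  · exact (Fintype.card_congr Perm.decomposeFin).symm

def Good {m : ℕ} (L : Fin m) (p σ : Perm (Fin m)) : Prop :=
  (p (σ L) : ℕ) = 0 ∧
  (∀ a, (a < σ a ∨ p a < p L) → (p (σ a) : ℕ) = p a + 1) ∧
  (∀ a b, a < b → (p b : ℕ) = p a + 1 → σ a = b)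

theorem good_step {m : ℕ} (L : Fin m) (e σ : Perm (Fin m)) (h : Good L e σ) (p : Fin (m + 1)) :
    Good L.succ (ins (p, e)) (Perm.decomposeFin.symm (p, σ)) := by
  obtain ⟨h1, h2, h3⟩ := h
  have s0 : Perm.decomposeFin.symm (p, σ) 0 = p := by simp
  have ss : ∀ x : Fin m, Perm.decomposeFin.symm (p, σ) x.succ
      = if (σ x).succ = p then 0 else (σ x).succ := by
    intro x
    rw [Perm.decomposeFin_symm_apply_succ, swap_apply_def]
    simp
  have i0 := ins_zero p e
  have is := ins_succ p e
  generalize ins (p, e) = w at *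
  generalize Perm.decomposeFin.symm (p, σ) = s at *
  induction p using Fin.cases with
  | zero =>
    have hq : insQ e 0 = Fin.last m := rfl
    rw [hq] at i0 is
    have is' : ∀ a : Fin m, (w a.succ : ℕ) = e a := by
      intro a; rw [is]; simp
    have ss' : ∀ x : Fin m, s x.succ = (σ x).succ := by
      intro a; rw [ss]; simp
    refine ⟨?_, ?_, ?_⟩
    · rw [ss', is', h1]
    · intro a
      induction a using Fin.cases with
      | zero =>
        rw [s0, i0, Fin.lt_def, Fin.lt_def, is']
        simp
      | succ a =>
        rw [ss', Fin.lt_def (a := w _), is', is', is', Fin.succ_lt_succ_iff]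
        exact h2 a
    · intro a b
      induction b using Fin.cases with
      | zero => simp
      | succ b =>
        induction a using Fin.cases with
        | zero =>
          rw [is', i0]; simp; omega
        | succ a =>
          rw [is', is', ss', Fin.succ_lt_succ_iff]
          intro x y; rw [h3 a b x y]
  | succ c =>
    have hq : insQ e c.succ = (e c).castSucc := rfl
    rw [hq] at i0 is
    simp only [Fin.succ_inj, Fin.val_castSucc] at ss is
    have i0' : (w 0 : ℕ) = e c := by rw [i0]; rfl
    have einj : ∀ x y, (e x : ℕ) = e y → x = y := fun x y h => e.injective (Fin.ext h)
    refine ⟨?_, ?_, ?_⟩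
    · rw [ss]
      split_ifs with h
      · rw [i0', ← h, h1]
      · rw [is]
        have : (e (σ L) : ℕ) ≠ e c := fun h' => h (einj _ _ h')
        rw [if_pos (by omega), h1]
    · intro a
      induction a using Fin.cases with
      | zero =>
        intro _
        rw [s0, i0', is]; simp
      | succ a =>
        rw [ss, Fin.lt_def (a := w _), is, is L]
        intro h
        have h2 := h2 a
        rw [Fin.lt_def (a := e _)] at h2
        clear h3
        have hlt : ((if (e a : ℕ) < e c then (e a : ℕ) else (e a : ℕ) + 1) <
            if (e L : ℕ) < e c then (e L : ℕ) else (e L : ℕ) + 1) → (e a : ℕ) < e L := by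
          intro h; split_ifs at h <;> omega
        by_cases h5 : σ a = c
        · rw [if_pos h5] at h ⊢
          have h6 := h2 (Or.inr (hlt (h.resolve_left (by simp))))
          rw [h5] at h6
          rw [i0', if_pos (by omega), h6]
        · rw [if_neg h5] at h ⊢
          have h6 := h2 (h.imp (fun h => by simpa using h) hlt)
          have h7 : (e (σ a) : ℕ) ≠ e c := fun h' => h5 (einj _ _ h')
          rw [is]
          split_ifs <;> omega
    · intro a b
      induction b using Fin.cases with
      | zero => simp
      | succ b =>
        induction a using Fin.cases with
        | zero =>
          rw [is, i0', s0]
          intro _ h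
          rw [einj b c]
          split_ifs at h <;> omega
        | succ a =>
          rw [is, is, ss, Fin.succ_lt_succ_iff]
          intro x y
          have h3 := h3 a b x
          by_cases hbc : b = c
          · subst hbc; split_ifs at y <;> omega
          · have : (e b : ℕ) ≠ e c := fun h' => hbc (einj _ _ h')
            by_cases hac : a = c
            · subst hac
              rw [h3 (by split_ifs at y <;> omega)]
              simp [hbc]
            · have : (e a : ℕ) ≠ e c := fun h' => hac (einj _ _ h')
              rw [h3 (by split_ifs at y <;> omega)]
              simp [hbc]

theorem foata (m : ℕ) : ∃ Φ : Perm (Fin (m + 1)) ≃ Perm (Fin (m + 1)),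
    ∀ p, Good (Fin.last m) p (Φ p) := by
  induction m with
  | zero =>
    refine ⟨Equiv.refl _, fun p => ⟨by omega, ?_, ?_⟩⟩
    · intro a h; exfalso; omega
    · intro a b h; exfalso; omega
  | succ m ih =>
    obtain ⟨Φ, hΦ⟩ := ih
    refine ⟨(Equiv.ofBijective _ ins_bij).symm.trans
      ((Equiv.prodCongr (Equiv.refl _) Φ).trans Perm.decomposeFin.symm), ?_⟩
    intro w
    obtain ⟨⟨p, e⟩, rfl⟩ := (Equiv.ofBijective _ (ins_bij (m := m + 1))).surjective w
    rw [Equiv.trans_apply, Equiv.symm_apply_apply]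
    exact good_step _ _ _ (hΦ e) p

/-- mirrored version, anchored at the minimum -/
theorem foata' (m : ℕ) : ∃ Φ : Perm (Fin (m + 1)) ≃ Perm (Fin (m + 1)),
    ∀ p, (p (Φ p 0) : ℕ) = 0 ∧
  (∀ a, (Φ p a < a ∨ p a < p 0) → (p (Φ p a) : ℕ) = p a + 1) ∧
  (∀ a b, b < a → (p b : ℕ) = p a + 1 → Φ p a = b) := by
  obtain ⟨Φ, hΦ⟩ := foata m
  refine ⟨(Equiv.mulRight (Fin.revPerm : Perm (Fin (m + 1)))).trans
    (Φ.trans (MulAut.conj (Fin.revPerm : Perm (Fin (m + 1)))).toEquiv), ?_⟩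
  intro p
  obtain ⟨h1, h2, h3⟩ := hΦ (p * Fin.revPerm)
  have e : ∀ a, ((Equiv.mulRight (Fin.revPerm : Perm (Fin (m + 1)))).trans
    (Φ.trans (MulAut.conj (Fin.revPerm : Perm (Fin (m + 1)))).toEquiv)) p a
      = Fin.rev (Φ (p * Fin.revPerm) (Fin.rev a)) := by
    intro a; rfl
  refine ⟨?_, ?_, ?_⟩
  · rw [e]; simpa using h1
  · intro a h
    rw [e] at h ⊢
    have := h2 (Fin.rev a)
    simp only [Perm.mul_apply, Fin.revPerm_apply, Fin.rev_rev, Fin.rev_last] at this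
    apply this
    rcases h with h | h
    · left; rw [← Fin.rev_lt_rev]; simpa using h
    · right; exact h
  · intro a b hab h
    rw [e]
    rw [h3 (Fin.rev a) (Fin.rev b) (by simpa using hab) (by simpa using h)]
    simp

theorem G_side (M k : ℕ) :
    Nat.card {π : Perm (Fin (M + 1)) // IsGI π ∧ FirstIs π (2 * k)} =
    Nat.card {σ : Perm (Fin (M + 1)) // (∀ a, a < σ a → Even (a : ℕ) ∧ Odd (σ a : ℕ)) ∧
      (σ (Fin.last M) : ℕ) + 1 = 2 * k} := by
  obtain ⟨Φ, hΦ⟩ := foata M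
  apply Nat.card_congr
  refine Equiv.subtypeEquiv ((Equiv.inv _).trans Φ) ?_
  intro π
  obtain ⟨h1, h2, h3⟩ := hΦ π⁻¹
  simp only [Equiv.trans_apply, Equiv.inv_apply]
  generalize Φ π⁻¹ = σ at *
  have e : ∀ x, π (π⁻¹ x) = x := fun x => by simp
  have e' : ∀ x, π⁻¹ (π x) = x := fun x => by simp
  apply and_congr
  · constructor
    · intro h a ha
      have := h (π⁻¹ a) (π⁻¹ (σ a)) (h2 a (Or.inl ha)).symm
      rw [e, e] at this
      have := this ha
      grind
    · intro h i j hij hlt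
      have := h3 (π i) (π j) hlt (by rw [e', e']; exact hij.symm)
      have h4 := h (π i)
      rw [this] at h4
      have := h4 hlt
      grind
  · have h4 : σ (Fin.last M) = π 0 := by
      have : π⁻¹ (σ (Fin.last M)) = 0 := Fin.ext h1
      rw [← this, e]
    rw [h4]
    constructor
    · intro h; exact h 0 rfl
    · intro h i hi
      have : i = 0 := Fin.ext hi
      rw [this]; exact h

def DRot {M : ℕ} (w : Perm (Fin (M + 1))) : Prop :=
  ∀ i j : Fin (M + 1), (i : ℕ) + 1 = j → w j < w i → Even (w i : ℕ) ∧ Even (w j : ℕ)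

theorem D_rot (M k : ℕ) (hM : Odd M) (w ω R : Perm (Fin (M + 1)))
    (r : ∀ i, (R i : ℕ) = if (i : ℕ) = M then 0 else (i : ℕ) + 1)
    (hω : ∀ i, ω (R i) = R (w i)) :
    (DRot w ∧ ∃ i, (w i : ℕ) + 2 = 2 * k ∧ ∀ j < i, ¬ Even (w j : ℕ)) ↔
      (IsDIII ω ∧ LeftmostEvenIs ω (2 * k)) := by
  have hR0 : R (Fin.last M) = 0 := by apply Fin.ext; rw [r]; simp
  have key : w (Fin.last M) = Fin.last M → ∀ i : Fin (M + 1), (i : ℕ) ≠ M →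
      (ω (R i) : ℕ) = w i + 1 := by
    intro h i hi
    rw [hω, r, if_neg]
    intro h'
    have h'' : w i = Fin.last M := Fin.ext h'
    have := w.injective (h''.trans h.symm)
    exact hi (by rw [this]; simp)
  have key0 : w (Fin.last M) = Fin.last M → ω 0 = 0 := by
    intro h
    rw [← hR0, hω, h]
  have hA : DRot w → w (Fin.last M) = Fin.last M := by
    intro h
    obtain ⟨i, hi⟩ := w.surjective (Fin.last M)
    by_cases hiM : (i : ℕ) = M
    · have : i = Fin.last M := Fin.ext hiM
      rwa [this] at hi
    · exfalso
      have hj : (i : ℕ) + 1 < M + 1 := by omega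
      have h1 := h i ⟨i + 1, hj⟩ rfl
      have h2 : w ⟨i + 1, hj⟩ ≠ w i := fun h => by
        have := congrArg Fin.val (w.injective h); simp at this
      have := (h1 (by rw [hi] at h2 ⊢; exact Fin.lt_last_iff_ne_last.2 h2)).1
      rw [hi] at this
      simp at this
      exact (Nat.not_even_iff_odd.2 hM) this
  have hB : IsDIII ω → w (Fin.last M) = Fin.last M := by
    intro h
    obtain ⟨i, hi⟩ := ω.surjective 0
    have hi0 : i = 0 := by
      by_contra hne
      have hpos : 0 < (i : ℕ) := Nat.pos_of_ne_zero fun h => hne (Fin.ext h)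
      have h1 := h ⟨i - 1, by omega⟩ i (by simp; omega)
      have h2 : ω ⟨i - 1, by omega⟩ ≠ ω i := fun h => by
        have := congrArg Fin.val (ω.injective h); simp at this; omega
      have := (h1 (by rw [hi] at h2 ⊢; exact Fin.pos_iff_ne_zero.2 h2)).2
      rw [hi] at this
      simp at this
    subst hi0
    apply R.injective
    rw [← hω, hR0, hi]
  have hAB : DRot w ↔ IsDIII ω := by
    constructor
    · intro h
      have hl := hA h
      have key := key hl
      intro i j hij hlt
      obtain ⟨i, rfl⟩ := R.surjective i
      obtain ⟨j, rfl⟩ := R.surjective j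
      by_cases hi : (i : ℕ) = M
      · have : i = Fin.last M := Fin.ext hi
        rw [this, hR0, key0 hl] at hlt
        simp at hlt
      · have ri := r i
        have rj := r j
        rw [if_neg hi] at ri
        have hj : (j : ℕ) ≠ M := by
          intro hj; rw [if_pos hj] at rj; omega
        rw [if_neg hj] at rj
        rw [Fin.lt_def, key i hi, key j hj] at hlt
        rw [key i hi, key j hj]
        have := h i j (by omega) (by rw [Fin.lt_def]; omega)
        grind
    · intro h
      have hl := hB h
      have key := key hl
      intro i j hij hlt
      have hi : (i : ℕ) ≠ M := by omega
      have hj : (j : ℕ) ≠ M := by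
        intro hj
        have : j = Fin.last M := Fin.ext hj
        rw [this, hl] at hlt
        exact absurd hlt (not_lt.2 (Fin.le_last _))
      have ri := r i
      have rj := r j
      rw [if_neg hi] at ri
      rw [if_neg hj] at rj
      have := h (R i) (R j) (by omega) (by rw [Fin.lt_def, key i hi, key j hj]; rw [Fin.lt_def] at hlt; omega)
      rw [key i hi, key j hj] at this
      grind
  rw [← hAB]
  apply and_congr_right
  intro h
  have hl := hA h
  have key := key hl
  constructor
  · rintro ⟨i, hi, hj⟩
    have hiM : (i : ℕ) ≠ M := by
      intro hj
      have : i = Fin.last M := Fin.ext hj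
      rw [this, hl] at hi
      simp at hi
      grind
    refine ⟨R i, by rw [key i hiM]; omega, ?_⟩
    intro j hlt
    obtain ⟨j, rfl⟩ := R.surjective j
    have ri := r i
    rw [if_neg hiM] at ri
    by_cases hjM : (j : ℕ) = M
    · have : j = Fin.last M := Fin.ext hjM
      rw [this, hR0, key0 hl]; simp
    · have rj := r j
      rw [if_neg hjM] at rj
      rw [key j hjM]
      rw [Fin.lt_def] at hlt
      have := hj j (by rw [Fin.lt_def]; omega)
      grind
  · rintro ⟨i, hi, hj⟩
    obtain ⟨i, rfl⟩ := R.surjective i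
    have hiM : (i : ℕ) ≠ M := by
      intro hj
      have : i = Fin.last M := Fin.ext hj
      rw [this, hR0, key0 hl] at hi
      simp at hi
      omega
    have ri := r i
    rw [if_neg hiM] at ri
    rw [key i hiM] at hi
    refine ⟨i, by omega, ?_⟩
    intro j hlt
    rw [Fin.lt_def] at hlt
    have hjM : (j : ℕ) ≠ M := by omega
    have rj := r j
    rw [if_neg hjM] at rj
    have := hj (R j) (by rw [Fin.lt_def]; omega)
    rw [key j hjM] at this
    grind

theorem lp_fe {M : ℕ} (P : Fin (M + 1) → Prop) (hP0 : P 0) (c : Fin (M + 1)) (hc : P c)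
    (w σ : Perm (Fin (M + 1))) (h1 : (w⁻¹ (σ 0) : ℕ) = 0)
    (h2 : ∀ a, w⁻¹ a < w⁻¹ 0 → (w⁻¹ (σ a) : ℕ) = w⁻¹ a + 1) :
    (∃ i, w i = c ∧ ∀ j < i, ¬ P (w j)) ↔ FE P σ 0 c := by
  have e : ∀ x, w (w⁻¹ x) = x := fun x => by simp
  have e' : ∀ x, w⁻¹ (w x) = x := fun x => by simp
  have fwd : ∀ i c, P c → w i = c → (∀ j < i, ¬ P (w j)) → FE P σ 0 c := by
    intro i c hc hi hj
    have hi0 : i ≤ w⁻¹ 0 := by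
      by_contra h
      have := hj _ (not_le.1 h)
      rw [e] at this; exact this hP0
    have step : ∀ a b, σ a = b → w⁻¹ b ≤ i → (∀ t, w⁻¹ b = t → t < i → FE P σ b c) →
        FE P σ a c := by
      intro a b hab hbi hrec
      rcases lt_or_eq_of_le hbi with h | h
      · have h3 := hj _ h
        rw [e] at h3
        apply FE.step
        · rwa [hab]
        · rw [hab]; exact hrec _ rfl h
      · have : b = c := by rw [← hi, ← h, e]
        rw [← this, ← hab]; apply FE.base; rw [hab, this]; exact hc
    have main : ∀ n : ℕ, ∀ b, w⁻¹ b < i → (i : ℕ) - w⁻¹ b = n → FE P σ b c := by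
      intro n
      induction n with
      | zero => intro b hb h; omega
      | succ n ih =>
        intro b hb h
        have h4 := h2 b (lt_of_lt_of_le hb hi0)
        apply step b (σ b) rfl (by rw [Fin.le_def, h4]; omega)
        intro t ht hti
        apply ih
        · rw [ht]; exact hti
        · omega
    apply step 0 (σ 0) rfl (by rw [Fin.le_def, h1]; omega)
    intro t ht hti
    exact main _ _ (by rw [ht]; exact hti) rfl
  constructor
  · rintro ⟨i, hi, hj⟩
    exact fwd i c hc hi hj
  · intro h
    obtain ⟨i, hi, hmin⟩ := (wellFounded_lt (α := Fin (M + 1))).has_min {i | P (w i)}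
      ⟨w⁻¹ 0, by simp only [Set.mem_ofPred_eq]; rw [e]; exact hP0⟩
    have hj : ∀ j < i, ¬ P (w j) := fun j hj hp => hmin j hp hj
    exact ⟨i, FE.unique (fwd i _ hi rfl hj) h, hj⟩

theorem D_side (M k : ℕ) (hM : Odd M) (c : Fin (M + 1)) (hc : (c : ℕ) + 2 = 2 * k) :
    Nat.card {ω : Perm (Fin (M + 1)) // IsDIII ω ∧ LeftmostEvenIs ω (2 * k)} =
    Nat.card {σ : Perm (Fin (M + 1)) // U (fun v : Fin (M + 1) => Even (v : ℕ)) σ ∧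
      FE (fun v : Fin (M + 1) => Even (v : ℕ)) σ 0 c} := by
  obtain ⟨Φ, hΦ⟩ := foata' M
  have r : ∀ i : Fin (M + 1), (finRotate (M + 1) i : ℕ) = if (i : ℕ) = M then 0 else (i : ℕ) + 1 := by
    intro i
    rw [coe_finRotate]
    simp [Fin.ext_iff]
  trans Nat.card {w : Perm (Fin (M + 1)) // DRot w ∧
    ∃ i, (w i : ℕ) + 2 = 2 * k ∧ ∀ j < i, ¬ Even (w j : ℕ)}
  · symm
    apply Nat.card_congr
    refine Equiv.subtypeEquiv (MulAut.conj (finRotate (M + 1))).toEquiv ?_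
    intro w
    apply D_rot M k hM w _ (finRotate (M + 1)) r
    intro i
    simp
  · apply Nat.card_congr
    refine Equiv.subtypeEquiv ((Equiv.inv _).trans Φ) ?_
    intro w
    obtain ⟨h1, h2, h3⟩ := hΦ w⁻¹
    simp only [Equiv.trans_apply, Equiv.inv_apply]
    generalize Φ w⁻¹ = σ at *
    have e : ∀ x, w (w⁻¹ x) = x := fun x => by simp
    have e' : ∀ x, w⁻¹ (w x) = x := fun x => by simp
    apply and_congr
    · constructor
      · intro h a ha
        have := h (w⁻¹ a) (w⁻¹ (σ a)) (h2 a (Or.inl ha)).symm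
        rw [e, e] at this
        exact this ha
      · intro h i j hij hlt
        have := h3 (w i) (w j) hlt (by rw [e', e']; exact hij.symm)
        have h4 := h (w i)
        rw [this] at h4
        exact h4 hlt
    · rw [← lp_fe (fun v : Fin (M + 1) => Even (v : ℕ)) (by simp) c (by grind) w σ h1
        (fun a h => h2 a (Or.inr h))]
      apply exists_congr
      intro i
      apply and_congr_left
      intro _
      rw [Fin.ext_iff]; omega

def psiN (d : ℕ) : ℕ := if d % 2 = 0 then d + 1 else d - 1
def phiN (M d : ℕ) : ℕ :=
  if d % 2 = 1 then (if d = M then M - 1 else d) else (if d = 0 then M else d - 2)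

theorem board (M k : ℕ) (hM : Odd M) (c : Fin (M + 1)) (hc : (c : ℕ) + 2 = 2 * k) :
    Nat.card {σ : Perm (Fin (M + 1)) // U (fun v : Fin (M + 1) => Even (v : ℕ)) σ ∧ σ c = 0} =
    Nat.card {σ : Perm (Fin (M + 1)) // (∀ a, a < σ a → Even (a : ℕ) ∧ Odd (σ a : ℕ)) ∧
      (σ (Fin.last M) : ℕ) + 1 = 2 * k} := by
  rw [Nat.odd_iff] at hM
  have hpsi : ∀ d : Fin (M + 1), psiN d < M + 1 := by
    intro d; unfold psiN; split_ifs <;> omega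
  have hphi : ∀ d : Fin (M + 1), phiN M d < M + 1 := by
    intro d; unfold phiN; split_ifs <;> omega
  have bpsi : Function.Bijective (fun d : Fin (M + 1) => (⟨psiN d, hpsi d⟩ : Fin (M + 1))) := by
    apply Finite.injective_iff_bijective.1
    intro a b h
    simp only [Fin.mk.injEq, psiN] at h
    apply Fin.ext
    split_ifs at h <;> omega
  have bphi : Function.Bijective (fun d : Fin (M + 1) => (⟨phiN M d, hphi d⟩ : Fin (M + 1))) := by
    apply Finite.injective_iff_bijective.1
    intro a b h
    simp only [Fin.mk.injEq, phiN] at h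
    apply Fin.ext
    split_ifs at h <;> omega
  obtain ⟨ψ, hψ⟩ : ∃ ψ : Perm (Fin (M + 1)), ∀ d, (ψ d : ℕ) = psiN d :=
    ⟨Equiv.ofBijective _ bpsi, fun d => rfl⟩
  obtain ⟨φ, hφ⟩ : ∃ φ : Perm (Fin (M + 1)), ∀ d, (φ d : ℕ) = phiN M d :=
    ⟨Equiv.ofBijective _ bphi, fun d => rfl⟩
  apply Nat.card_congr
  refine Equiv.subtypeEquiv ((Equiv.inv _).trans
    ((Equiv.mulLeft ψ).trans (Equiv.mulRight φ⁻¹))) ?_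
  intro σ
  have hρ : ∀ d, ((Equiv.inv _).trans
    ((Equiv.mulLeft ψ).trans (Equiv.mulRight φ⁻¹))) σ (φ d) = ψ (σ⁻¹ d) := by
    intro d; simp
  generalize ((Equiv.inv _).trans
    ((Equiv.mulLeft ψ).trans (Equiv.mulRight φ⁻¹))) σ = ρ at *
  have hφ0 : φ 0 = Fin.last M := by apply Fin.ext; rw [hφ]; simp [phiN]
  have hlast : (ρ (Fin.last M) : ℕ) + 1 = 2 * k ↔ σ c = 0 := by
    have : σ c = 0 ↔ σ⁻¹ 0 = c := by
      rw [Perm.inv_eq_iff_eq]; exact eq_comm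
    rw [this, ← hφ0, hρ, hψ, Fin.ext_iff, psiN]
    split_ifs <;> omega
  rw [hlast]
  apply and_congr_left
  intro hc0
  have hρ' : ∀ a, (ρ (φ (σ a)) : ℕ) = psiN a := by
    intro a; rw [hρ, hψ]; simp
  have main : ∀ a, (σ a < a → Even (a : ℕ) ∧ Even (σ a : ℕ)) ↔
      (φ (σ a) < ρ (φ (σ a)) → Even (φ (σ a) : ℕ) ∧ Odd (ρ (φ (σ a)) : ℕ)) := by
    intro a
    have hac : (σ a : ℕ) = 0 → (a : ℕ) = c := by
      intro h
      have : σ a = σ c := by rw [hc0]; exact Fin.ext h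
      rw [σ.injective this]
    simp only [Fin.lt_def, hρ', hφ, Nat.even_iff, Nat.odd_iff]
    have h1 := a.isLt
    have h2 := (σ a).isLt
    generalize (σ a : ℕ) = d at *
    generalize (a : ℕ) = e at *
    unfold psiN phiN
    split_ifs <;> omega
  constructor
  · intro h g
    obtain ⟨d, rfl⟩ := φ.surjective g
    obtain ⟨a, rfl⟩ := σ.surjective d
    exact (main a).1 (h a)
  · intro h a
    exact (main a).2 (h _)

theorem final (m n k : ℕ) (hm : m = 2 * n) (hn : 1 ≤ n) (hk1 : 1 ≤ k) (hkn : k ≤ n) :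
    Nat.card {π : Equiv.Perm (Fin m) // IsGI π ∧ FirstIs π (2 * k)} =
      Nat.card {σ : Equiv.Perm (Fin m) // IsDIII σ ∧ LeftmostEvenIs σ (2 * k)} := by
  obtain ⟨M, rfl⟩ : ∃ M, m = M + 1 := ⟨m - 1, by omega⟩
  have hM : Odd M := by rw [Nat.odd_iff]; omega
  have hc : ((⟨2 * k - 2, by omega⟩ : Fin (M + 1)) : ℕ) + 2 = 2 * k := by simp; omega
  rw [G_side, D_side M k hM _ hc, card_FE _ _ _ (by simp) (by rw [Nat.even_iff]; omega)
    (fun a => Fin.zero_le a), board M k hM _ hc]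

end Foata

/-- For all `n ≥ 1` and `1 ≤ k ≤ n`, `|G^I_{2n,2k}| = |D^III_{2n,2k}|`. -/
theorem card_GI_eq_card_DIII (n k : ℕ) (hn : 1 ≤ n) (hk1 : 1 ≤ k) (hkn : k ≤ n) :
    Nat.card {π : Equiv.Perm (Fin (2 * n)) // IsGI π ∧ FirstIs π (2 * k)} =
      Nat.card {σ : Equiv.Perm (Fin (2 * n)) // IsDIII σ ∧ LeftmostEvenIs σ (2 * k)} :=
  Foata.final (2 * n) n k rfl hn hk1 hkn
end
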